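/- arXiv:math/0506066 — 2 statements merged into one kernel-verified Lean document; each statement's English description precedes it below -/
import Mathlib

section
/- Let A and C be finitely generated K-algebras such that C is a commutative domain with field of fractions Q; set B := C ⊗_K A and 𝓑 := Q ⊗_K A. Let M be a finitely generated B-module such that 𝓜 := 𝓑 ⊗_B M ≠ 0. Then GK(M as a B-module, over K) ≥ GK_Q(𝓜 as a 𝓑-module) + GK(C), where GK_Q denotes the Gelfand-Kirillov dimension over the field Q. -/
/- Common definitions: degree of a function, standard finite-dimensional filtrations,
Gelfand-Kirillov dimension, return functions and filter dimensions (V. Bavula,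
"Filter dimension"), and the Rentschler–Gabriel (left) Krull dimension via deviation. -/

open Filter

noncomputable section

/-- The degree `γ(f)` (as an extended real) of a function `f : ℕ → ℕ∞`:
`inf { r : ℝ | f i ≤ i ^ r for all sufficiently large i }` (`⊤` if no such `r` exists). -/
def gammaDeg (f : ℕ → ℕ∞) : EReal :=
  sInf { x : EReal | ∃ r : ℝ, x = (r : EReal) ∧
    ∀ᶠ i in atTop, f i ≤ (⌊(i : ℝ) ^ r⌋₊ : ℕ∞) }

/-- `V` is the degree-one piece of a standard finite-dimensional filtration `{A_i = V ^ i}`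
of the `K`-algebra `A`: it is finite-dimensional, contains `1` and generates `A`
(this is the filtration associated with a finite set of algebra generators). -/
structure IsStdFilt (K A : Type) [Field K] [Ring A] [Algebra K A] (V : Submodule K A) :
    Prop where
  one_mem : (1 : A) ∈ V
  fin : FiniteDimensional K V
  gen : Algebra.adjoin K (V : Set A) = ⊤

/-- The Gelfand-Kirillov dimension `GK(A) = γ(i ↦ dim A_i)` of the algebra `A` w.r.t. the
standard filtration `{A_i = V ^ i}`. -/
def gkAlg (K A : Type) [Field K] [Ring A] [Algebra K A] (V : Submodule K A) : EReal :=
  gammaDeg fun i => (Module.finrank K (V ^ i : Submodule K A) : ℕ∞)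

/-- The `K`-subspace `p • W` of the module `M` spanned by products `a • w`, `a ∈ p`, `w ∈ W`. -/
def smulSub (K : Type) [Field K] {A M : Type} [Ring A] [Algebra K A] [AddCommGroup M]
    [Module K M] [Module A M] [IsScalarTower K A M] (p : Submodule K A) (W : Submodule K M) :
    Submodule K M :=
  Submodule.span K {x : M | ∃ a ∈ p, ∃ w ∈ W, x = a • w}

/-- `W` is a finite-dimensional generating subspace of the `A`-module `M`. -/
def IsGenSub (K A : Type) {M : Type} [Field K] [Ring A] [Algebra K A] [AddCommGroup M]
    [Module K M] [Module A M] [IsScalarTower K A M] (W : Submodule K M) : Prop :=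
  FiniteDimensional K W ∧ Submodule.span A (W : Set M) = ⊤

/-- The Gelfand-Kirillov dimension `GK(M) = γ(i ↦ dim M_i)` of the module `M` w.r.t. the
standard filtration `{M_i = V ^ i • W}`. -/
def gkModW (K : Type) [Field K] {A M : Type} [Ring A] [Algebra K A] [AddCommGroup M]
    [Module K M] [Module A M] [IsScalarTower K A M] (V : Submodule K A) (W : Submodule K M) :
    EReal :=
  gammaDeg fun i => (Module.finrank K (smulSub K (V ^ i) W) : ℕ∞)

/-- The Gelfand-Kirillov dimension of a module, as the infimum over all finite-dimensional
generating subspaces (it agrees with `gkModW` for each of them). -/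
def gkMod (K A M : Type) [Field K] [Ring A] [Algebra K A] [AddCommGroup M] [Module K M]
    [Module A M] [IsScalarTower K A M] (V : Submodule K A) : EReal :=
  ⨅ W : {W : Submodule K M // IsGenSub K A W}, gkModW K V W.1

/-- The return function `ν_{F,W}` of the `A`-module `M` associated with the standard
filtration `F = {V ^ i}` of `A` and the generating subspace `W` of `M`:
`ν(i) = min { j | V ^ j • N ⊇ W for every generating subspace N ⊆ V ^ i • W }`. -/
def retMod (K : Type) [Field K] {A M : Type} [Ring A] [Algebra K A] [AddCommGroup M]
    [Module K M] [Module A M] [IsScalarTower K A M] (V : Submodule K A) (W : Submodule K M)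
    (i : ℕ) : ℕ∞ :=
  sInf { j : ℕ∞ | ∃ n : ℕ, j = (n : ℕ∞) ∧ ∀ N : Submodule K M,
      Submodule.span A (N : Set M) = ⊤ → N ≤ smulSub K (V ^ i) W →
      W ≤ smulSub K (V ^ n) N }

/-- The filter dimension `fd(M) = γ(ν_{F,W})` of the `A`-module `M`. -/
def fdModW (K : Type) [Field K] {A M : Type} [Ring A] [Algebra K A] [AddCommGroup M]
    [Module K M] [Module A M] [IsScalarTower K A M] (V : Submodule K A) (W : Submodule K M) :
    EReal :=
  gammaDeg (retMod K V W)

/-- The return function `ν_F` of a (simple) algebra `A` w.r.t. the standard filtration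
`F = {A_i = V ^ i}`: `ν_F(i) = min { j | 1 ∈ A_j a A_j for all 0 ≠ a ∈ A_i }`, where
`A_j a A_j` is the `K`-span of `{ x * a * y | x, y ∈ A_j }`. -/
def nuFn (K : Type) [Field K] {A : Type} [Ring A] [Algebra K A] (V : Submodule K A)
    (i : ℕ) : ℕ∞ :=
  sInf { j : ℕ∞ | ∃ n : ℕ, j = (n : ℕ∞) ∧ ∀ a ∈ (V ^ i : Submodule K A), a ≠ 0 →
    (1 : A) ∈ Submodule.span K
      {x : A | ∃ u ∈ (V ^ n : Submodule K A), ∃ w ∈ (V ^ n : Submodule K A), x = u * a * w} }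

/-- The left return function `λ_F` of a (simple) algebra `A`:
`λ_F(i) = min { j | 1 ∈ A a A_j for all 0 ≠ a ∈ A_i }`, where `A a A_j` is the left ideal
of `A` generated by the set `a A_j`. -/
def lamFn (K : Type) [Field K] {A : Type} [Ring A] [Algebra K A] (V : Submodule K A)
    (i : ℕ) : ℕ∞ :=
  sInf { j : ℕ∞ | ∃ n : ℕ, j = (n : ℕ∞) ∧ ∀ a ∈ (V ^ i : Submodule K A), a ≠ 0 →
    (1 : A) ∈ Submodule.span A {x : A | ∃ w ∈ (V ^ n : Submodule K A), x = a * w} }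

/-- The filter dimension `fd(A) = γ(ν_F)` of a simple finitely generated algebra `A`. -/
def fdAlg (K : Type) [Field K] {A : Type} [Ring A] [Algebra K A] (V : Submodule K A) : EReal :=
  gammaDeg (nuFn K V)

/-- The left filter dimension `lfd(A) = γ(λ_F)` of a simple finitely generated algebra `A`. -/
def lfdAlg (K : Type) [Field K] {A : Type} [Ring A] [Algebra K A] (V : Submodule K A) : EReal :=
  gammaDeg (lamFn K V)

/-- `DevLE n α` : the deviation of the poset `α` is at most `n`. -/
def DevLE : ℕ → (α : Type) → [inst : Preorder α] → Prop
  | 0, α, _ => ∀ f : ℕ → α, Antitone f → ∀ᶠ i in atTop, ¬ f (i + 1) < f i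
  | n + 1, α, _ => ∀ f : ℕ → α, Antitone f →
      ∀ᶠ i in atTop, DevLE n (Set.Icc (f (i + 1)) (f i))

open Classical in
/-- The left Krull dimension in the sense of Rentschler–Gabriel of the `A`-module `M`:
the deviation of the poset of submodules of `M`, as an extended real (`⊥` for the zero
module, `⊤` if the deviation is not a natural number). For `M = A` this is the left Krull
dimension `K.dim A` of the ring `A`. -/
def kdimE (A M : Type) [Ring A] [AddCommGroup M] [Module A M] : EReal :=
  if Subsingleton M then ⊥
  else sInf { x : EReal | ∃ n : ℕ, x = (n : EReal) ∧ DevLE n (Submodule A M) }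


theorem gammaDeg_le_of_bound (f : ℕ → ℕ) (c s : ℝ)
    (h : ∀ᶠ i : ℕ in atTop, (f i : ℝ) ≤ c * (i : ℝ) ^ s) :
    gammaDeg (fun i => (f i : ℕ∞)) ≤ (s : EReal) := by
  rw [← EReal.le_of_forall_lt_iff_le]
  intro z hz
  have hz' : 0 < z - s := sub_pos.mpr (EReal.coe_lt_coe_iff.mp hz)
  apply sInf_le
  refine ⟨z, rfl, ?_⟩
  have ht : Tendsto (fun i : ℕ => (i : ℝ) ^ (z - s)) atTop atTop :=
    (tendsto_rpow_atTop hz').comp tendsto_natCast_atTop_atTop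
  filter_upwards [h, ht.eventually_ge_atTop c, eventually_gt_atTop 0] with i h1 h2 h3
  have hi : (0 : ℝ) < i := by exact_mod_cast h3
  have : (f i : ℝ) ≤ (i : ℝ) ^ z := by
    calc (f i : ℝ) ≤ c * (i : ℝ) ^ s := h1
      _ ≤ (i : ℝ) ^ (z - s) * (i : ℝ) ^ s := by gcongr
      _ = (i : ℝ) ^ z := by rw [← Real.rpow_add hi]; congr 1; ring
  exact_mod_cast Nat.le_floor this

theorem fg_le_of_chain {K V : Type} [Field K] [AddCommGroup V] [Module K V]
    (U : ℕ → Submodule K V) (hU : Monotone U) (G : Submodule K V) (hG : G.FG)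
    (h : ∀ x ∈ G, ∃ n, x ∈ U n) : ∃ n, G ≤ U n := by
  classical
  obtain ⟨s, rfl⟩ := hG
  choose! n hn using h
  refine ⟨s.sup n, Submodule.span_le.mpr fun x hx => ?_⟩
  exact hU (Finset.le_sup hx) (hn x (Submodule.subset_span hx))

theorem std_mono {K A : Type} [Field K] [Ring A] [Algebra K A] {V : Submodule K A}
    (h1 : (1 : A) ∈ V) : Monotone (fun n : ℕ => V ^ n) :=
  fun _ _ h => pow_le_pow_right₀ (Submodule.one_le.mpr h1) h

theorem std_exh {K A : Type} [Field K] [Ring A] [Algebra K A] {V : Submodule K A}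
    (h : IsStdFilt K A V) (a : A) : ∃ n : ℕ, a ∈ V ^ n := by
  have ha : a ∈ Algebra.adjoin K (V : Set A) := by rw [h.gen]; trivial
  induction ha using Algebra.adjoin_induction with
  | mem x hx => exact ⟨1, by simpa using hx⟩
  | algebraMap r => exact ⟨0, by simpa using ⟨r, rfl⟩⟩
  | add x y _ _ hx hy =>
    obtain ⟨n, hn⟩ := hx
    obtain ⟨m, hm⟩ := hy
    exact ⟨max n m, add_mem (std_mono h.one_mem (le_max_left _ _) hn)
      (std_mono h.one_mem (le_max_right _ _) hm)⟩
  | mul x y _ _ hx hy =>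
    obtain ⟨n, hn⟩ := hx
    obtain ⟨m, hm⟩ := hy
    exact ⟨n + m, by rw [pow_add]; exact Submodule.mul_mem_mul hn hm⟩

theorem mul_left_le {K A : Type} [Field K] [Ring A] [Algebra K A] {U V W : Submodule K A}
    (h : U ≤ V) : U * W ≤ V * W := mul_le_mul' h le_rfl

theorem mul_right_le {K A : Type} [Field K] [Ring A] [Algebra K A] {U V W : Submodule K A}
    (h : U ≤ V) : W * U ≤ W * V := mul_le_mul' le_rfl h

/-- span of the monomials with all exponents at most `n` -/
def boxSpan (K : Type) {C : Type} [Field K] [CommRing C] [Algebra K C] {d : ℕ} (x : Fin d → C)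
    (n : ℕ) : Submodule K C :=
  Submodule.span K (Set.range fun α : Fin d → Fin (n + 1) => ∏ j, x j ^ (α j : ℕ))

theorem mono_mem_boxSpan {K C : Type} [Field K] [CommRing C] [Algebra K C] {d : ℕ}
    (x : Fin d → C) (n : ℕ) (α : Fin d → ℕ) (h : ∀ j, α j ≤ n) :
    ∏ j, x j ^ α j ∈ boxSpan K x n :=
  Submodule.subset_span ⟨fun j => ⟨α j, Nat.lt_succ_of_le (h j)⟩, rfl⟩

theorem boxSpan_mono {K C : Type} [Field K] [CommRing C] [Algebra K C] {d : ℕ}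
    (x : Fin d → C) : Monotone (boxSpan K x) := by
  intro a b hab
  refine Submodule.span_le.mpr ?_
  rintro _ ⟨α, rfl⟩
  exact mono_mem_boxSpan x b _ fun j => (Nat.le_of_lt_succ (α j).2).trans hab

theorem boxSpan_mul {K C : Type} [Field K] [CommRing C] [Algebra K C] {d : ℕ}
    (x : Fin d → C) (a b : ℕ) : boxSpan K x a * boxSpan K x b ≤ boxSpan K x (a + b) := by
  rw [boxSpan, boxSpan, Submodule.span_mul_span]
  refine Submodule.span_le.mpr ?_
  rintro _ ⟨_, ⟨α, rfl⟩, _, ⟨β, rfl⟩, rfl⟩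
  have : (∏ j, x j ^ (α j : ℕ)) * (∏ j, x j ^ (β j : ℕ)) =
      ∏ j, x j ^ ((α j : ℕ) + (β j : ℕ)) := by
    rw [← Finset.prod_mul_distrib]; simp [pow_add]
  simp only [this]
  exact mono_mem_boxSpan x _ _ fun j => by have := (α j).2; have := (β j).2; omega

theorem finrank_boxSpan_mul {K C : Type} [Field K] [CommRing C] [Algebra K C] {d k : ℕ}
    (x : Fin d → C) (m : Fin k → C) (n : ℕ) :
    Module.Finite K (boxSpan K x n * Submodule.span K (Set.range m) : Submodule K C) ∧
    Module.finrank K (boxSpan K x n * Submodule.span K (Set.range m) : Submodule K C) ≤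
      (n + 1) ^ d * k := by
  have : (boxSpan K x n * Submodule.span K (Set.range m) : Submodule K C) =
      Submodule.span K (Set.range fun p : (Fin d → Fin (n + 1)) × Fin k =>
        (∏ j, x j ^ (p.1 j : ℕ)) * m p.2) := by
    rw [boxSpan, Submodule.span_mul_span]
    congr 1
    ext y
    simp [Set.mem_mul]
  rw [this]
  refine ⟨Module.Finite.span_of_finite K (Set.finite_range _), (finrank_range_le_card _).trans ?_⟩
  simp

theorem noether_growth (K C : Type) [Field K] [CommRing C] [Algebra K C] [IsDomain C]
    (VC : Submodule K C) (hV : IsStdFilt K C VC) :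
    ∃ (d : ℕ) (x : Fin d → C), LinearIndependent K (fun α : Fin d → ℕ => ∏ j, x j ^ α j) ∧
      gkAlg K C VC ≤ ((d : ℝ) : EReal) := by
  classical
  have hFG : VC.FG := Submodule.fg_iff_finiteDimensional _ |>.mpr hV.fin
  have : Algebra.FiniteType K C := by
    obtain ⟨s, hs⟩ := hFG
    refine ⟨⟨s, ?_⟩⟩
    rw [← hV.gen, ← hs, Algebra.adjoin_span]
  obtain ⟨d, g, hinj, hfin⟩ := exists_finite_inj_algHom_of_fg K C
  have hmon : ∀ α : Fin d →₀ ℕ, g (MvPolynomial.monomial α 1) =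
      ∏ j, g (MvPolynomial.X j) ^ α j := by
    intro α
    rw [MvPolynomial.monomial_eq, Finsupp.prod_fintype _ _ (by simp)]
    simp
  refine ⟨d, fun j => g (MvPolynomial.X j), ?_, ?_⟩
  · have h1 := (MvPolynomial.basisMonomials (Fin d) K).linearIndependent
    have h2 := h1.map' g.toLinearMap (LinearMap.ker_eq_bot.mpr hinj)
    have h3 := h2.comp (Finsupp.equivFunOnFinite.symm : (Fin d → ℕ) ≃ (Fin d →₀ ℕ))
      (Equiv.injective _)
    have h4 : (fun α : Fin d → ℕ => ∏ j, g (MvPolynomial.X j) ^ α j) =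
        ((⇑g.toLinearMap ∘ ⇑(MvPolynomial.basisMonomials (Fin d) K)) ∘
          ⇑Finsupp.equivFunOnFinite.symm) := by
      funext α
      simp [hmon]
    rw [h4]
    exact h3
  set x : Fin d → C := fun j => g (MvPolynomial.X j) with hx
  have hbox : ∀ p, ∃ n, g p ∈ boxSpan K x n := by
    intro p
    induction p using MvPolynomial.induction_on' with
    | monomial α a =>
      refine ⟨∑ j, α j, ?_⟩
      have : MvPolynomial.monomial α a = a • MvPolynomial.monomial α (1 : K) := by
        simp [MvPolynomial.smul_monomial]
      rw [this, map_smul, hmon]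
      exact Submodule.smul_mem _ _ (mono_mem_boxSpan x _ _ fun j =>
        Finset.single_le_sum (f := fun j => α j) (fun _ _ => Nat.zero_le _) (Finset.mem_univ j))
    | add p q hp hq =>
      obtain ⟨n, hn⟩ := hp
      obtain ⟨m, hm⟩ := hq
      exact ⟨max n m, by
        rw [map_add]
        exact add_mem (boxSpan_mono x (le_max_left _ _) hn)
          (boxSpan_mono x (le_max_right _ _) hm)⟩
  obtain ⟨k, m, hm1, hm⟩ : ∃ (k : ℕ) (m : Fin k → C), (1 : C) ∈ Set.range m ∧
      ∀ c : C, ∃ n, c ∈ boxSpan K x n * Submodule.span K (Set.range m) := by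
    let _ : Algebra (MvPolynomial (Fin d) K) C := g.toRingHom.toAlgebra
    have : Module.Finite (MvPolynomial (Fin d) K) C := hfin
    obtain ⟨k, m, hm⟩ := Module.Finite.exists_fin (R := MvPolynomial (Fin d) K) (M := C)
    refine ⟨k + 1, Fin.cons 1 m, ⟨0, rfl⟩, fun c => ?_⟩
    have hc : c ∈ Submodule.span (MvPolynomial (Fin d) K) (Set.range m) := by rw [hm]; trivial
    induction hc using Submodule.span_induction with
    | mem y hy =>
      obtain ⟨i, rfl⟩ := hy
      refine ⟨0, ?_⟩
      rw [← one_mul (m i)]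
      refine Submodule.mul_mem_mul ?_ (Submodule.subset_span ⟨i.succ, by simp⟩)
      simpa using mono_mem_boxSpan (K := K) x 0 (fun _ => 0) (fun _ => le_rfl)
    | zero => exact ⟨0, zero_mem _⟩
    | add y z _ _ hy hz =>
      obtain ⟨n, hn⟩ := hy
      obtain ⟨n', hn'⟩ := hz
      exact ⟨max n n', add_mem (mul_left_le (boxSpan_mono x (le_max_left _ _)) hn)
          (mul_left_le (boxSpan_mono x (le_max_right _ _)) hn')⟩
    | smul p y _ hy =>
      obtain ⟨n, hn⟩ := hy
      obtain ⟨n', hn'⟩ := hbox p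
      refine ⟨n' + n, mul_left_le (boxSpan_mul x n' n) ?_⟩
      rw [mul_assoc]
      exact Submodule.mul_mem_mul hn' hn
  set F := Submodule.span K (Set.range m) with hF
  obtain ⟨D, hD⟩ : ∃ D, VC * F ≤ boxSpan K x D * F := by
    apply fg_le_of_chain (fun n => boxSpan K x n * F)
      (fun a b h => mul_left_le (boxSpan_mono x h)) _
      (hFG.mul (Submodule.fg_span (Set.finite_range m)))
    exact fun c _ => hm c
  have hpow : ∀ i : ℕ, VC ^ i * F ≤ boxSpan K x (D * i) * F := by
    intro i
    induction i with
    | zero =>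
      refine mul_left_le ?_
      rw [pow_zero, Submodule.one_le]
      simpa using mono_mem_boxSpan (K := K) x (D * 0) (fun _ => 0) (fun _ => Nat.zero_le _)
    | succ i ih =>
      calc VC ^ (i + 1) * F = VC * (VC ^ i * F) := by rw [pow_succ', mul_assoc]
        _ ≤ VC * (boxSpan K x (D * i) * F) := mul_right_le ih
        _ = boxSpan K x (D * i) * (VC * F) := by rw [mul_left_comm]
        _ ≤ boxSpan K x (D * i) * (boxSpan K x D * F) := mul_right_le hD
        _ = (boxSpan K x (D * i) * boxSpan K x D) * F := by rw [mul_assoc]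
        _ ≤ boxSpan K x (D * (i + 1)) * F := mul_left_le (boxSpan_mul x _ _)
  have hdim : ∀ i : ℕ, Module.finrank K (VC ^ i : Submodule K C) ≤ (D * i + 1) ^ d * k := by
    intro i
    obtain ⟨h1, h2⟩ := finrank_boxSpan_mul (K := K) x m (D * i)
    refine le_trans ?_ h2
    refine Submodule.finrank_mono (le_trans ?_ (hpow i))
    intro c hc
    rw [← mul_one c]
    exact Submodule.mul_mem_mul hc (Submodule.subset_span hm1)
  refine gammaDeg_le_of_bound _ (((D : ℝ) + 1) ^ d * k) d ?_
  filter_upwards [eventually_ge_atTop 1] with i hi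
  have hi' : (1 : ℝ) ≤ i := by exact_mod_cast hi
  calc (Module.finrank K (VC ^ i : Submodule K C) : ℝ) ≤ ((D : ℝ) * i + 1) ^ d * k := by
        exact_mod_cast hdim i
    _ ≤ (((D : ℝ) + 1) * i) ^ d * k := by gcongr; linarith
    _ = ((D : ℝ) + 1) ^ d * k * (i : ℝ) ^ (d : ℝ) := by
      rw [Real.rpow_natCast, mul_pow]; ring

theorem smulSub_mem {K A M : Type} [Field K] [Ring A] [Algebra K A] [AddCommGroup M]
    [Module K M] [Module A M] [IsScalarTower K A M] {p : Submodule K A} {W : Submodule K M}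
    {a : A} {w : M} (ha : a ∈ p) (hw : w ∈ W) : a • w ∈ smulSub K p W :=
  Submodule.subset_span ⟨a, ha, w, hw, rfl⟩

theorem smulSub_mul_mem {K A M : Type} [Field K] [Ring A] [Algebra K A] [AddCommGroup M]
    [Module K M] [Module A M] [IsScalarTower K A M] {p q : Submodule K A} {W : Submodule K M}
    {a : A} {m : M} (ha : a ∈ p) (hm : m ∈ smulSub K q W) : a • m ∈ smulSub K (p * q) W := by
  have hc : ∀ (k : K) (y : M), a • (k • y) = k • (a • y) := by
    intro k y
    rw [← algebraMap_smul A k y, ← algebraMap_smul A k (a • y), smul_smul, smul_smul,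
      Algebra.commutes]
  induction hm using Submodule.span_induction with
  | mem y hy =>
    obtain ⟨b, hb, w, hw, rfl⟩ := hy
    rw [smul_smul]
    exact smulSub_mem (Submodule.mul_mem_mul ha hb) hw
  | zero => rw [smul_zero]; exact zero_mem _
  | add y z _ _ hy hz => rw [smul_add]; exact add_mem hy hz
  | smul k y _ hy => rw [hc]; exact Submodule.smul_mem _ _ hy

theorem smulSub_fg {K A M : Type} [Field K] [Ring A] [Algebra K A] [AddCommGroup M]
    [Module K M] [Module A M] [IsScalarTower K A M] {p : Submodule K A} {W : Submodule K M}
    (hp : p.FG) (hW : W.FG) : (smulSub K p W).FG := by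
  obtain ⟨s, rfl⟩ := hp
  obtain ⟨t, rfl⟩ := hW
  have h : smulSub K (Submodule.span K (s : Set A)) (Submodule.span K (t : Set M)) ≤
      Submodule.span K ((fun q : A × M => q.1 • q.2) '' ((s : Set A) ×ˢ (t : Set M))) := by
    refine Submodule.span_le.mpr ?_
    rintro _ ⟨a, ha, w, hw, rfl⟩
    change a • w ∈ Submodule.span K _
    induction ha using Submodule.span_induction with
    | mem a ha =>
      induction hw using Submodule.span_induction with
      | mem w hw => exact Submodule.subset_span ⟨(a, w), ⟨ha, hw⟩, rfl⟩
      | zero => rw [smul_zero]; exact zero_mem _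
      | add y z _ _ hy hz => rw [smul_add]; exact add_mem hy hz
      | smul k y _ hy =>
        have : a • (k • y) = k • (a • y) := by
          rw [← algebraMap_smul A k y, ← algebraMap_smul A k (a • y), smul_smul, smul_smul,
            Algebra.commutes]
        rw [this]; exact Submodule.smul_mem _ _ hy
    | zero => rw [zero_smul]; exact zero_mem _
    | add y z _ _ hy hz => rw [add_smul]; exact add_mem hy hz
    | smul k y _ hy => rw [smul_assoc]; exact Submodule.smul_mem _ _ hy
  have hfin : Module.Finite K (Submodule.span K
      ((fun q : A × M => q.1 • q.2) '' ((s : Set A) ×ˢ (t : Set M)))) :=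
    Module.Finite.span_of_finite K ((s.finite_toSet.prod t.finite_toSet).image _)
  exact Submodule.fg_iff_finiteDimensional _ |>.mpr (Submodule.finiteDimensional_of_le h)

theorem tower_indep {K Q N : Type} [Field K] [Field Q] [Algebra K Q] [AddCommGroup N]
    [Module Q N] {κ ι : Type} [Fintype κ] [Fintype ι] (q : κ → Q) (u : ι → N)
    (hq : LinearIndependent K q) (hu : LinearIndependent Q u) (a : κ × ι → K)
    (h : ∑ p, (algebraMap K Q (a p) * q p.1) • u p.2 = 0) : ∀ p, a p = 0 := by
  rw [Fintype.sum_prod_type_right] at h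
  simp only [← Finset.sum_smul] at h
  have h1 := Fintype.linearIndependent_iff.mp hu _ h
  rintro ⟨k, i⟩
  have h2 := h1 i
  simp only [← Algebra.smul_def] at h2
  exact Fintype.linearIndependent_iff.mp hq (fun k => a (k, i)) h2 k

section key
variable {K Q B D M N : Type} [Field K] [Field Q] [Algebra K Q] [Ring B] [Algebra K B]
  [Ring D] [Algebra Q D] [AddCommGroup M] [Module K M] [Module B M] [IsScalarTower K B M]
  [AddCommGroup N] [Module Q N] [Module D N] [IsScalarTower Q D N]

theorem key_lower (φ : B →+* D) (hφ : ∀ k : K, φ (algebraMap K B k) = algebraMap Q D (algebraMap K Q k))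
    (f : M →+ N) (hf : ∀ b m, f (b • m) = φ b • f m)
    (V : Submodule K B) (hV : V.FG) (W : Submodule K M) (hW : W.FG) (a b : ℕ)
    {κ : Type} [Fintype κ] (y : κ → B) (q : κ → Q) (hq : LinearIndependent K q)
    (hy : ∀ k, y k ∈ V ^ a) (hyq : ∀ k, φ (y k) = algebraMap Q D (q k))
    [Module.Finite Q (Submodule.span Q (f '' (smulSub K (V ^ b) W : Set M)))] :
    Fintype.card κ *
      Module.finrank Q (Submodule.span Q (f '' (smulSub K (V ^ b) W : Set M))) ≤
      Module.finrank K (smulSub K (V ^ (a + b)) W) := by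
  obtain ⟨u, hu, -, hui⟩ := Submodule.exists_fun_fin_finrank_span_eq Q
    (f '' (smulSub K (V ^ b) W : Set M))
  choose m hm hmu using hu
  have hfd : Module.Finite K (smulSub K (V ^ (a + b)) W) :=
    Submodule.fg_iff_finiteDimensional _ |>.mp (smulSub_fg (hV.pow _) hW)
  let z : κ × Fin (Module.finrank Q (Submodule.span Q (f '' (smulSub K (V ^ b) W : Set M)))) →
      smulSub K (V ^ (a + b)) W := fun p => ⟨y p.1 • m p.2, by
        rw [pow_add]; exact smulSub_mul_mem (hy _) (hm _)⟩
  have hz : LinearIndependent K z := by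
    rw [Fintype.linearIndependent_iff]
    intro c hc
    apply tower_indep q u hq hui c
    have h1 : ∑ p, c p • (y p.1 • m p.2) = 0 := by
      have := congrArg Subtype.val hc
      simpa [z] using this
    have h2 := congrArg f h1
    rw [map_sum, map_zero] at h2
    rw [← h2]
    refine Finset.sum_congr rfl fun p _ => ?_
    rw [← algebraMap_smul B (c p), hf, hf, hφ, hyq, hmu, algebraMap_smul,
      algebraMap_smul D (q p.1), smul_smul]
  have := hz.fintype_card_le_finrank
  simpa using this

theorem key_upper (φ : B →+* D) (f : M →+ N) (hf : ∀ b m, f (b • m) = φ b • f m)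
    (hφ : ∀ k : K, φ (algebraMap K B k) = algebraMap Q D (algebraMap K Q k))
    (hspan : Submodule.span Q (Set.range φ) = ⊤)
    (V : Submodule K B) (hV : IsStdFilt K B V) (W : Submodule K M)
    (VQ : Submodule Q D) (hVQ : VQ.FG) :
    ∃ e : ℕ, ∀ i : ℕ, smulSub Q (VQ ^ i) (Submodule.span Q (f '' (W : Set M))) ≤
      Submodule.span Q (f '' (smulSub K (V ^ (e * i)) W : Set M)) := by
  let U : ℕ → Submodule Q D := fun n => Submodule.span Q (φ '' ((V ^ n : Submodule K B) : Set B))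
  have hU : Monotone U := fun a b h => Submodule.span_mono (Set.image_mono (std_mono hV.one_mem h))
  obtain ⟨e, he⟩ : ∃ e, VQ ≤ U e := by
    refine fg_le_of_chain U hU VQ hVQ fun x hxV => ?_
    clear hxV
    have hx : x ∈ Submodule.span Q (Set.range φ) := by rw [hspan]; trivial
    induction hx using Submodule.span_induction with
    | mem y hy =>
      obtain ⟨b, rfl⟩ := hy
      obtain ⟨n, hn⟩ := std_exh hV b
      exact ⟨n, Submodule.subset_span ⟨b, hn, rfl⟩⟩
    | zero => exact ⟨0, zero_mem _⟩
    | add y z _ _ hy hz =>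
      obtain ⟨n, hn⟩ := hy
      obtain ⟨n', hn'⟩ := hz
      exact ⟨max n n', add_mem (hU (le_max_left _ _) hn) (hU (le_max_right _ _) hn')⟩
    | smul k y _ hy =>
      obtain ⟨n, hn⟩ := hy
      exact ⟨n, Submodule.smul_mem _ _ hn⟩
  have hmul : ∀ a b, U a * U b ≤ U (a + b) := by
    intro a b
    simp only [U]
    rw [Submodule.span_mul_span]
    refine Submodule.span_le.mpr ?_
    rintro _ ⟨_, ⟨s, hs, rfl⟩, _, ⟨t, ht, rfl⟩, rfl⟩
    refine Submodule.subset_span ⟨s * t, ?_, by simp⟩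
    rw [pow_add]
    exact Submodule.mul_mem_mul hs ht
  have hpow : ∀ i : ℕ, VQ ^ i ≤ U (e * i) := by
    intro i
    induction i with
    | zero =>
      rw [pow_zero, Submodule.one_le]
      exact Submodule.subset_span ⟨1, by simpa using ⟨1, map_one _⟩, map_one _⟩
    | succ i ih =>
      calc VQ ^ (i + 1) = VQ ^ i * VQ := pow_succ _ _
        _ ≤ U (e * i) * U e := mul_le_mul' ih he
        _ ≤ U (e * (i + 1)) := hmul _ _
  refine ⟨e, fun i => Submodule.span_le.mpr ?_⟩
  rintro _ ⟨a, ha, w, hw, rfl⟩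
  replace ha := hpow i ha
  change a • w ∈ Submodule.span Q _
  induction ha using Submodule.span_induction with
  | mem a hab =>
    obtain ⟨b, hb, rfl⟩ := hab
    induction hw using Submodule.span_induction with
    | mem w hw =>
      obtain ⟨m, hm, rfl⟩ := hw
      rw [← hf]
      exact Submodule.subset_span ⟨_, smulSub_mem hb hm, rfl⟩
    | zero => rw [smul_zero]; exact zero_mem _
    | add y z _ _ hy hz => rw [smul_add]; exact add_mem hy hz
    | smul k y _ hy =>
      have : φ b • (k • y) = k • (φ b • y) := by
        rw [← algebraMap_smul D k y, ← algebraMap_smul D k (φ b • y), smul_smul, smul_smul,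
          Algebra.commutes]
      rw [this]; exact Submodule.smul_mem _ _ hy
  | zero => rw [zero_smul]; exact zero_mem _
  | add y z _ _ hy hz => rw [add_smul]; exact add_mem hy hz
  | smul k y _ hy => rw [smul_assoc]; exact Submodule.smul_mem _ _ hy

theorem span_image_fg (f : M →+ N) (hf : ∀ (k : K) m, f (k • m) = algebraMap K Q k • f m)
    (S : Submodule K M) (hS : S.FG) : (Submodule.span Q (f '' (S : Set M))).FG := by
  obtain ⟨t, rfl⟩ := hS
  have h : Submodule.span Q (f '' ((Submodule.span K (t : Set M) : Submodule K M) : Set M)) ≤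
      Submodule.span Q (f '' (t : Set M)) := by
    refine Submodule.span_le.mpr ?_
    rintro _ ⟨m, hm, rfl⟩
    change m ∈ Submodule.span K (t : Set M) at hm
    change f m ∈ Submodule.span Q _
    induction hm using Submodule.span_induction with
    | mem w hw => exact Submodule.subset_span ⟨w, hw, rfl⟩
    | zero => rw [map_zero]; exact zero_mem _
    | add y z _ _ hy hz => rw [map_add]; exact add_mem hy hz
    | smul k y _ hy => rw [hf]; exact Submodule.smul_mem _ _ hy
  have hfin : Module.Finite Q (Submodule.span Q (f '' (t : Set M))) :=
    Module.Finite.span_of_finite Q (t.finite_toSet.image _)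
  exact Submodule.fg_iff_finiteDimensional _ |>.mpr (Submodule.finiteDimensional_of_le h)

theorem key_dim {C : Type} [CommRing C] [Algebra K C]
    (φ : B →+* D) (f : M →+ N) (hf : ∀ b m, f (b • m) = φ b • f m)
    (hφ : ∀ k : K, φ (algebraMap K B k) = algebraMap Q D (algebraMap K Q k))
    (hspan : Submodule.span Q (Set.range φ) = ⊤)
    (V : Submodule K B) (hV : IsStdFilt K B V) (W : Submodule K M) (hW : W.FG)
    (VQ : Submodule Q D) (hVQ : VQ.FG)
    (inc : C →ₐ[K] B) (jq : C →ₐ[K] Q) (hj : Function.Injective jq)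
    (hinc : ∀ c, φ (inc c) = algebraMap Q D (jq c))
    (d : ℕ) (x : Fin d → C)
    (hx : LinearIndependent K (fun α : Fin d → ℕ => ∏ j, x j ^ α j)) :
    ∃ E : ℕ, 0 < E ∧ ∀ i : ℕ,
      i ^ d * Module.finrank Q (smulSub Q (VQ ^ i) (Submodule.span Q (f '' (W : Set M)))) ≤
      Module.finrank K (smulSub K (V ^ (E * i)) W) := by
  classical
  have hVfg : V.FG := Submodule.fg_iff_finiteDimensional _ |>.mpr hV.fin
  have hfK : ∀ (k : K) m, f (k • m) = algebraMap K Q k • f m := by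
    intro k m
    rw [← algebraMap_smul B k m, hf, hφ, algebraMap_smul]
  obtain ⟨e, he⟩ := key_upper φ f hf hφ hspan V hV W VQ hVQ
  obtain ⟨a, ha⟩ : ∃ a, ∀ j, inc (x j) ∈ V ^ a := by
    choose n hn using fun j => std_exh hV (inc (x j))
    exact ⟨Finset.univ.sup n, fun j => std_mono hV.one_mem (Finset.le_sup (Finset.mem_univ j)) (hn j)⟩
  have hprod : ∀ (i : ℕ) (α : Fin d → ℕ), (∀ j, α j ≤ i) → ∀ s : Finset (Fin d),
      inc (∏ j ∈ s, x j ^ α j) ∈ V ^ (a * i * s.card) := by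
    intro i α hα s
    induction s using Finset.induction_on with
    | empty => simpa using (⟨1, map_one _⟩ : ∃ k : K, algebraMap K B k = 1)
    | insert j s hjs ih =>
      rw [Finset.prod_insert hjs, Finset.card_insert_of_notMem hjs, map_mul, map_pow,
        show a * i * (s.card + 1) = a * i + a * i * s.card by ring, pow_add]
      refine Submodule.mul_mem_mul ?_ ih
      refine std_mono hV.one_mem (Nat.mul_le_mul_left a (hα j)) ?_
      change _ ∈ V ^ (a * α j)
      rw [pow_mul]
      exact Submodule.pow_mem_pow _ (ha j) _
  refine ⟨a * d + e + 1, Nat.succ_pos _, fun i => ?_⟩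
  have hfin : Module.Finite Q (Submodule.span Q (f '' (smulSub K (V ^ (e * i)) W : Set M))) :=
    Submodule.fg_iff_finiteDimensional _ |>.mp
      (span_image_fg f hfK _ (smulSub_fg (hVfg.pow _) hW))
  have hli : LinearIndependent K (fun α : Fin d → Fin i => jq (∏ j, x j ^ (α j : ℕ))) := by
    have h1 := hx.map' jq.toLinearMap (LinearMap.ker_eq_bot.mpr hj)
    exact h1.comp (fun (α : Fin d → Fin i) j => (α j : ℕ)) (fun α β h => by
      funext j; exact Fin.ext (congrFun h j))
  have h := key_lower φ hφ f hf V hVfg W hW (a * i * d) (e * i)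
    (fun α : Fin d → Fin i => inc (∏ j, x j ^ (α j : ℕ)))
    (fun α => jq (∏ j, x j ^ (α j : ℕ))) hli
    (fun α => by simpa using hprod i (fun j => α j) (fun j => (α j).2.le) Finset.univ)
    (fun α => hinc _)
  have hcard : Fintype.card (Fin d → Fin i) = i ^ d := by simp
  rw [hcard] at h
  have hfd : Module.Finite K (smulSub K (V ^ ((a * d + e + 1) * i)) W) :=
    Submodule.fg_iff_finiteDimensional _ |>.mp (smulSub_fg (hVfg.pow _) hW)
  calc _ ≤ i ^ d * Module.finrank Q
        (Submodule.span Q (f '' (smulSub K (V ^ (e * i)) W : Set M))) :=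
        Nat.mul_le_mul_left _ (Submodule.finrank_mono (he i))
    _ ≤ _ := h
    _ ≤ _ := by
      refine Submodule.finrank_mono (Submodule.span_mono ?_)
      rintro _ ⟨b, hb, w, hw, rfl⟩
      refine ⟨b, std_mono hV.one_mem ?_ hb, w, hw, rfl⟩
      nlinarith

theorem key_gk {C : Type} [CommRing C] [Algebra K C]
    (φ : B →+* D) (f : M →+ N) (hf : ∀ b m, f (b • m) = φ b • f m)
    (hφ : ∀ k : K, φ (algebraMap K B k) = algebraMap Q D (algebraMap K Q k))
    (hspan : Submodule.span Q (Set.range φ) = ⊤)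
    (V : Submodule K B) (hV : IsStdFilt K B V) (W : Submodule K M) (hW : W.FG)
    (VQ : Submodule Q D) (hVQ : VQ.FG)
    (inc : C →ₐ[K] B) (jq : C →ₐ[K] Q) (hj : Function.Injective jq)
    (hinc : ∀ c, φ (inc c) = algebraMap Q D (jq c))
    (d : ℕ) (x : Fin d → C)
    (hx : LinearIndependent K (fun α : Fin d → ℕ => ∏ j, x j ^ α j)) :
    gkModW Q VQ (Submodule.span Q (f '' (W : Set M))) + ((d : ℝ) : EReal) ≤ gkModW K V W := by
  obtain ⟨E, hE, hdim⟩ := key_dim φ f hf hφ hspan V hV W hW VQ hVQ inc jq hj hinc d x hx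
  refine le_sInf ?_
  rintro _ ⟨r, rfl, hr⟩
  have hmain : gkModW Q VQ (Submodule.span Q (f '' (W : Set M))) ≤ ((r - d : ℝ) : EReal) := by
    refine gammaDeg_le_of_bound _ ((E : ℝ) ^ r) (r - d) ?_
    have ht : Tendsto (fun i : ℕ => E * i) atTop atTop :=
      tendsto_id.const_mul_atTop' hE
    filter_upwards [ht.eventually hr, eventually_gt_atTop 0] with i h1 h2
    have hi : (0 : ℝ) < i := by exact_mod_cast h2
    have h3 : Module.finrank K (smulSub K (V ^ (E * i)) W) ≤ ⌊((E * i : ℕ) : ℝ) ^ r⌋₊ := by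
      exact_mod_cast h1
    have h4 : (Module.finrank K (smulSub K (V ^ (E * i)) W) : ℝ) ≤ ((E * i : ℕ) : ℝ) ^ r :=
      (Nat.cast_le.mpr h3).trans (Nat.floor_le (by positivity))
    have h5 : ((i : ℝ) ^ d * (Module.finrank Q
        (smulSub Q (VQ ^ i) (Submodule.span Q (f '' (W : Set M)))) : ℝ)) ≤
        (E : ℝ) ^ r * (i : ℝ) ^ r := by
      rw [← Real.mul_rpow (by positivity) hi.le]
      refine le_trans ?_ (h4.trans (by push_cast; exact le_rfl))
      exact_mod_cast hdim i
    rw [Real.rpow_sub hi, Real.rpow_natCast, ← mul_div_assoc, le_div_iff₀ (by positivity), mul_comm]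
    exact h5
  calc _ ≤ ((r - d : ℝ) : EReal) + ((d : ℝ) : EReal) := add_le_add_left hmain _
    _ = (r : EReal) := by rw [← EReal.coe_add]; simp

end key

open TensorProduct in
set_option maxHeartbeats 1000000 in
set_option synthInstance.maxHeartbeats 1000000 in
/-- Let `A` and `C` be finitely generated `K`-algebras with `C` a commutative domain with
field of fractions `Q`, and put `B := C ⊗_K A`, `𝓑 := Q ⊗_K A`. Let `M` be a finitely
generated `B`-module such that `𝓜 := 𝓑 ⊗_B M ≠ 0`. Then
`GK(M) ≥ GK_Q(𝓜) + GK(C)`. Since `𝓑` is the (central) localization of `B` at the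
nonzero elements of `C`, the module `𝓜 = 𝓑 ⊗_B M` is presented here by a `B`-equivariant
`K`-linear map `f : M → N` exhibiting `N` as the localization of `M` at `C \ {0}`. -/
theorem gk_ge_gk_fraction_add_gk
    (K C A : Type) [Field K] [CommRing C] [Algebra K C] [IsDomain C]
    [Ring A] [Algebra K A]
    (M : Type) [AddCommGroup M] [Module K M] [Module (C ⊗[K] A) M]
    [IsScalarTower K (C ⊗[K] A) M] [Module.Finite (C ⊗[K] A) M]
    (N : Type) [AddCommGroup N] [Module K N] [Module (FractionRing C) N]
    [Module ((FractionRing C) ⊗[K] A) N]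
    [IsScalarTower (FractionRing C) ((FractionRing C) ⊗[K] A) N]
    [Nontrivial N]
    (f : M →ₗ[K] N)
    (hf : ∀ (b : C ⊗[K] A) (m : M),
      f (b • m) =
        (Algebra.TensorProduct.map (IsScalarTower.toAlgHom K C (FractionRing C))
          (AlgHom.id K A) b) • f m)
    (hsurj : ∀ x : N, ∃ c : nonZeroDivisors C, ∃ m : M,
      (algebraMap C (FractionRing C) (c : C)) • x = f m)
    (hker : ∀ m : M, f m = 0 → ∃ c : nonZeroDivisors C,
      (((c : C) ⊗ₜ[K] (1 : A)) : C ⊗[K] A) • m = 0) :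
    ∀ VB : Submodule K (C ⊗[K] A), IsStdFilt K (C ⊗[K] A) VB →
    ∀ VC : Submodule K C, IsStdFilt K C VC →
    ∀ VQ : Submodule (FractionRing C) ((FractionRing C) ⊗[K] A),
      IsStdFilt (FractionRing C) ((FractionRing C) ⊗[K] A) VQ →
      gkMod (FractionRing C) ((FractionRing C) ⊗[K] A) N VQ + gkAlg K C VC ≤
        gkMod K (C ⊗[K] A) M VB := by
  intro VB hVB VC hVC VQ hVQ
  obtain ⟨d, x, hx, hd⟩ := noether_growth K C VC hVC
  refine le_iInf fun W => ?_
  set φ := Algebra.TensorProduct.map (IsScalarTower.toAlgHom K C (FractionRing C))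
          (AlgHom.id K A) with hφdef
  have hφt : ∀ (c : C) (a : A), φ (c ⊗ₜ[K] a) = (algebraMap C (FractionRing C) c) ⊗ₜ[K] a := by
    intro c a
    simp [φ]
  have hspan : Submodule.span (FractionRing C) (Set.range φ.toRingHom) = ⊤ := by
    rw [eq_top_iff]
    rintro z -
    induction z using TensorProduct.induction_on with
    | zero => exact zero_mem _
    | add y z hy hz => exact add_mem hy hz
    | tmul q a =>
      have : q ⊗ₜ[K] a = q • φ.toRingHom ((1 : C) ⊗ₜ[K] a) := by
        change _ = q • φ ((1 : C) ⊗ₜ[K] a)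
        rw [hφt, map_one, TensorProduct.smul_tmul', smul_eq_mul, mul_one]
      rw [this]
      exact Submodule.smul_mem _ _ (Submodule.subset_span ⟨_, rfl⟩)
  have hW : W.1.FG := Submodule.fg_iff_finiteDimensional _ |>.mpr W.2.1
  have hφC : ∀ c : C, φ (c ⊗ₜ[K] (1 : A)) =
      algebraMap (FractionRing C) (FractionRing C ⊗[K] A) (algebraMap C (FractionRing C) c) := by
    intro c
    rw [hφt, Algebra.TensorProduct.algebraMap_apply]
    rfl
  have hφK : ∀ k : K, φ.toRingHom (algebraMap K (C ⊗[K] A) k) =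
      algebraMap (FractionRing C) (FractionRing C ⊗[K] A) (algebraMap K (FractionRing C) k) := by
    intro k
    change φ (algebraMap K (C ⊗[K] A) k) = _
    rw [Algebra.TensorProduct.algebraMap_apply, hφC,
      IsScalarTower.algebraMap_apply K C (FractionRing C)]
  have key := key_gk φ.toRingHom f.toAddMonoidHom hf hφK hspan VB hVB W.1 hW VQ
    (Submodule.fg_iff_finiteDimensional _ |>.mpr hVQ.fin)
    (Algebra.TensorProduct.includeLeft : C →ₐ[K] C ⊗[K] A)
    (IsScalarTower.toAlgHom K C (FractionRing C)) (IsFractionRing.injective C (FractionRing C))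
    hφC d x hx
  refine le_trans (add_le_add ?_ hd) key
  refine iInf_le_of_le ⟨_, ?_⟩ le_rfl
  refine ⟨Submodule.fg_iff_finiteDimensional _ |>.mp
    (span_image_fg (K := K) f.toAddMonoidHom ?_ W.1 hW), ?_⟩
  · intro k m
    change f (k • m) = _ • f m
    rw [← algebraMap_smul (C ⊗[K] A) k m, hf]
    exact (congrArg (· • f m) (hφK k)).trans (algebraMap_smul _ _ _)
  · set S := Submodule.span (FractionRing C ⊗[K] A)
      ((Submodule.span (FractionRing C) (f.toAddMonoidHom '' (W.1 : Set M)) :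
        Submodule (FractionRing C) N) : Set N) with hS
    have hm : ∀ m : M, f m ∈ S := by
      intro m
      have hmW : m ∈ Submodule.span (C ⊗[K] A) (W.1 : Set M) := by rw [W.2.2]; trivial
      induction hmW using Submodule.span_induction with
      | mem w hw => exact Submodule.subset_span (Submodule.subset_span ⟨w, hw, rfl⟩)
      | zero => rw [map_zero]; exact zero_mem _
      | add y z _ _ hy hz => rw [map_add]; exact add_mem hy hz
      | smul k y _ hy => rw [hf]; exact Submodule.smul_mem _ _ hy
    rw [eq_top_iff]
    rintro z -
    obtain ⟨c, m, hc⟩ := hsurj z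
    have hc0 : algebraMap C (FractionRing C) (c : C) ≠ 0 := by
      simpa using nonZeroDivisors.ne_zero c.2
    have hz : z = algebraMap (FractionRing C) (FractionRing C ⊗[K] A)
        (algebraMap C (FractionRing C) (c : C))⁻¹ • f m := by
      rw [algebraMap_smul, ← hc, smul_smul, inv_mul_cancel₀ hc0, one_smul]
    rw [hz]
    exact Submodule.smul_mem _ _ (hm m)

end
end

section
/- Let A be a central simple finitely generated K-algebra of Gelfand-Kirillov dimension 0 < n < ∞, and let C be a commutative subalgebra of A. Then GK(C) ≤ GK(A)·(1 − 1/(f_A + max{f_A, 1})), where f_A := max { d_{Q_m}(Q_m ⊗_K A) | 0 ≤ m ≤ n }, Q_0 := K, and Q_m := K(x_1,…,x_m) is the rational function field in m indeterminates. -/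
/- Common definitions: degree of a function, standard finite-dimensional filtrations,
Gelfand-Kirillov dimension, return functions and filter dimensions (V. Bavula,
"Filter dimension"), and the Rentschler–Gabriel (left) Krull dimension via deviation. -/

open Filter

noncomputable section

/-- The Gelfand-Kirillov dimension of a (not necessarily finitely generated) subalgebra
`C` of `A`: the supremum over all finite-dimensional subspaces `U ∋ 1` of `C` of
`γ(i ↦ dim U^i)`. -/
def gkSubalgebra (K A : Type) [Field K] [Ring A] [Algebra K A] (C : Subalgebra K A) :
    EReal :=
  ⨆ U : {U : Submodule K ↥C // FiniteDimensional K ↥U ∧ (1 : ↥C) ∈ U},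
    gammaDeg fun i => (Module.finrank K ((U : Submodule K ↥C) ^ i : Submodule K ↥C) : ℕ∞)

lemma gd_ev {f : ℕ → ℕ∞} {r s : ℝ} (h : gammaDeg f ≤ r) (hs : r < s) :
    ∀ᶠ i : ℕ in atTop, f i ≤ (⌊(i : ℝ) ^ s⌋₊ : ℕ∞) := by
  have h1 : gammaDeg f < (s : EReal) := lt_of_le_of_lt h (by exact_mod_cast hs)
  unfold gammaDeg at h1
  rw [sInf_lt_iff] at h1
  obtain ⟨x, ⟨q, rfl, hq⟩, hx⟩ := h1
  have hqs : q < s := by exact_mod_cast hx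
  filter_upwards [hq, eventually_ge_atTop 1] with i hi h1
  refine hi.trans ?_
  have : ⌊(i : ℝ) ^ q⌋₊ ≤ ⌊(i : ℝ) ^ s⌋₊ :=
    Nat.floor_mono (Real.rpow_le_rpow_of_exponent_le (by exact_mod_cast h1) hqs.le)
  exact_mod_cast this

lemma gd_bound {g : ℕ → ℕ} {r s : ℝ} (h : gammaDeg (fun i => (g i : ℕ∞)) ≤ r) (hs : r < s) :
    ∃ C : ℝ, 0 < C ∧ ∀ i : ℕ, 1 ≤ i → (g i : ℝ) ≤ C * (i : ℝ) ^ s := by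
  have h1 := gd_ev h hs
  obtain ⟨N, hN⟩ := eventually_atTop.1 h1
  refine ⟨1 + ∑ j ∈ Finset.range N, (g j : ℝ) / (j : ℝ) ^ s, by positivity, fun i hi => ?_⟩
  have hpos : (0 : ℝ) < (i : ℝ) ^ s := Real.rpow_pos_of_pos (by exact_mod_cast hi) _
  by_cases hiN : N ≤ i
  · have h2 := hN i hiN
    have h3 : g i ≤ ⌊(i : ℝ) ^ s⌋₊ := by exact_mod_cast h2
    have h4 : (g i : ℝ) ≤ (i : ℝ) ^ s := (Nat.cast_le.2 h3).trans (Nat.floor_le hpos.le)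
    have h5 : (0 : ℝ) ≤ ∑ j ∈ Finset.range N, (g j : ℝ) / (j : ℝ) ^ s := by positivity
    nlinarith
  · have h2 : (g i : ℝ) / (i : ℝ) ^ s ≤ ∑ j ∈ Finset.range N, (g j : ℝ) / (j : ℝ) ^ s :=
      Finset.single_le_sum (f := fun j : ℕ => (g j : ℝ) / (j : ℝ) ^ s)
        (fun j _ => by positivity) (Finset.mem_range.2 (by omega))
    rw [div_le_iff₀ hpos] at h2
    linarith

lemma gd_le {g : ℕ → ℕ} {r : ℝ}
    (h : ∀ s > r, ∃ C : ℝ, ∀ᶠ i : ℕ in atTop, (g i : ℝ) ≤ C * (i : ℝ) ^ s) :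
    gammaDeg (fun i => (g i : ℕ∞)) ≤ r := by
  refine le_of_forall_gt_imp_ge_of_dense ?_
  intro x hx
  induction x with
  | bot => simp at hx
  | top => exact le_top
  | coe x =>
    have hx : r < x := by exact_mod_cast hx
    obtain ⟨C, hC⟩ := h ((r + x) / 2) (by show r < _; linarith)
    refine sInf_le ⟨x, rfl, ?_⟩
    have h1 : Tendsto (fun i : ℕ => (i : ℝ) ^ ((x - r) / 2)) atTop atTop :=
      (tendsto_rpow_atTop (by linarith)).comp tendsto_natCast_atTop_atTop
    filter_upwards [hC, h1.eventually_ge_atTop C, eventually_ge_atTop 1] with i h2 h3 h4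
    have hi : (0 : ℝ) < i := by exact_mod_cast h4
    have : g i ≤ ⌊(i : ℝ) ^ x⌋₊ := by
      apply Nat.le_floor
      refine h2.trans ?_
      have : (i : ℝ) ^ x = (i : ℝ) ^ ((x - r) / 2) * (i : ℝ) ^ ((r + x) / 2) := by
        rw [← Real.rpow_add hi]; congr 1; ring
      rw [this]
      gcongr
    exact_mod_cast this

lemma num_poly {g : ℕ → ℕ} (N c m : ℕ) (h : ∀ i, g i ≤ N * (c * (i + 1) + 1) ^ m) :
    gammaDeg (fun i => (g i : ℕ∞)) ≤ ((m : ℝ) : EReal) := by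
  apply gd_le
  intro s hs
  refine ⟨N * (2 * c + 1) ^ m, ?_⟩
  filter_upwards [eventually_ge_atTop 1] with i hi
  have hi' : (1 : ℝ) ≤ i := by exact_mod_cast hi
  have h1 : (g i : ℝ) ≤ N * (c * (i + 1) + 1) ^ m := by exact_mod_cast h i
  refine h1.trans ?_
  rw [mul_assoc]
  gcongr
  calc ((c : ℝ) * (i + 1) + 1) ^ m ≤ ((2 * c + 1) * i) ^ m := by
        gcongr
        have : (0 : ℝ) ≤ c := by positivity
        nlinarith
    _ = (2 * c + 1) ^ m * (i : ℝ) ^ (m : ℝ) := by rw [mul_pow, Real.rpow_natCast]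
    _ ≤ _ := by
        gcongr

lemma num_bound {d e : ℕ → ℕ} {n : ℝ} (m k : ℕ) (hk : 1 ≤ k)
    (he : gammaDeg (fun i => (e i : ℕ∞)) = (n : EReal))
    (h : ∀ i, d i * (i + 1) ^ m ≤ e (k * i)) {s : ℝ} (hs : n < s) :
    ∃ C : ℝ, 0 < C ∧ ∀ i : ℕ, 1 ≤ i → (d i : ℝ) ≤ C * (i : ℝ) ^ (s - m) := by
  obtain ⟨C, hC, h1⟩ := gd_bound he.le hs
  refine ⟨C * (k : ℝ) ^ s, by positivity, fun i hi => ?_⟩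
  have hi' : (0 : ℝ) < i := by exact_mod_cast hi
  have h2 := h1 (k * i) (Nat.mul_pos hk hi)
  have h3 : (d i : ℝ) * (i + 1) ^ m ≤ e (k * i) := by exact_mod_cast h i
  rw [Real.rpow_sub hi', Real.rpow_natCast, mul_div_assoc', le_div_iff₀ (by positivity)]
  calc (d i : ℝ) * (i : ℝ) ^ m ≤ (d i : ℝ) * (i + 1) ^ m := by gcongr; linarith
    _ ≤ _ := h3.trans h2
    _ = _ := by push_cast; rw [Real.mul_rpow (by positivity) (by positivity)]; ring

lemma num_m_le {d e : ℕ → ℕ} {n : ℝ} (m k : ℕ) (hk : 1 ≤ k)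
    (he : gammaDeg (fun i => (e i : ℕ∞)) = (n : EReal)) (hd : ∀ i, 1 ≤ d i)
    (h : ∀ i, d i * (i + 1) ^ m ≤ e (k * i)) : (m : ℝ) ≤ n := by
  by_contra hlt
  push Not at hlt
  obtain ⟨C, hC, h1⟩ := num_bound m k hk he h (s := (n + m) / 2) (by linarith)
  have h2 : Tendsto (fun i : ℕ => (i : ℝ) ^ ((m - n) / 2)) atTop atTop :=
      (tendsto_rpow_atTop (by linarith)).comp tendsto_natCast_atTop_atTop
  obtain ⟨i, hi1, hi2⟩ := ((h2.eventually_gt_atTop C).and (eventually_ge_atTop 1)).exists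
  have hi' : (0 : ℝ) < i := by exact_mod_cast hi2
  have h3 := h1 i hi2
  have h4 : (1 : ℝ) ≤ d i := by exact_mod_cast hd i
  have h5 : (i : ℝ) ^ ((n + m) / 2 - m) = ((i : ℝ) ^ ((m - n) / 2))⁻¹ := by
    rw [← Real.rpow_neg hi'.le]; congr 1; ring
  rw [h5, ← div_eq_mul_inv] at h3
  have h6 := h4.trans h3
  rw [le_div_iff₀ (by positivity)] at h6
  linarith

lemma num_main {d e : ℕ → ℕ} {n F : ℝ} (m k : ℕ) (hk : 1 ≤ k) (hF : 0 ≤ F)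
    (he : gammaDeg (fun i => (e i : ℕ∞)) = (n : EReal)) (hmn : (m : ℝ) ≤ n)
    (h : ∀ i, d i * (i + 1) ^ m ≤ e (k * i))
    (h' : ∀ t > F, ∀ᶠ i : ℕ in atTop, e i ≤ d ⌊(i : ℝ) ^ t⌋₊ * d (⌊(i : ℝ) ^ t⌋₊ + i)) :
    n ≤ (F + max F 1) * (n - m) := by
  have key : ∀ ε : ℝ, 0 < ε → n ≤ ((F + ε) + max (F + ε) 1) * (n + ε - m) := by
    intro ε hε
    obtain ⟨C, hC, h1⟩ := num_bound m k hk he h (s := n + ε) (by linarith)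
    have hq : 0 < n + ε - m := by linarith
    set q := n + ε - m with hqdef
    set t := F + ε with ht
    have ht0 : 0 < t := by linarith
    have : gammaDeg (fun i => (e i : ℕ∞)) ≤ (((t + max t 1) * q : ℝ) : EReal) := by
      apply gd_le
      intro s hs
      refine ⟨C * (C * 2 ^ q), ?_⟩
      filter_upwards [h' t (by show F < F + ε; linarith), eventually_ge_atTop 1] with i h2 hi
      have hi1 : (1 : ℝ) ≤ i := by exact_mod_cast hi
      have hi0 : (0 : ℝ) < i := by linarith
      have hit : (1 : ℝ) ≤ (i : ℝ) ^ t := Real.one_le_rpow hi1 ht0.le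
      set l := ⌊(i : ℝ) ^ t⌋₊ with hl
      have hl1 : 1 ≤ l := Nat.le_floor (by exact_mod_cast hit)
      have hl2 : (l : ℝ) ≤ (i : ℝ) ^ t := Nat.floor_le (by linarith)
      have h3 := h1 l hl1
      have h4 := h1 (l + i) (by omega)
      have h5 : (l : ℝ) ^ q ≤ (i : ℝ) ^ (t * q) := by
        rw [Real.rpow_mul hi0.le]
        exact Real.rpow_le_rpow (by positivity) hl2 hq.le
      have h6 : ((l + i : ℕ) : ℝ) ^ q ≤ 2 ^ q * (i : ℝ) ^ (max t 1 * q) := by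
        rw [Real.rpow_mul hi0.le, ← Real.mul_rpow (by norm_num) (by positivity)]
        refine Real.rpow_le_rpow (by positivity) ?_ hq.le
        have a1 : (i : ℝ) ^ t ≤ (i : ℝ) ^ (max t 1) :=
          Real.rpow_le_rpow_of_exponent_le hi1 (le_max_left _ _)
        have a2 : (i : ℝ) ^ (1 : ℝ) ≤ (i : ℝ) ^ (max t 1) :=
          Real.rpow_le_rpow_of_exponent_le hi1 (le_max_right _ _)
        rw [Real.rpow_one] at a2
        push_cast
        linarith
      have hexp : (t + max t 1) * q = t * q + max t 1 * q := by ring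
      calc (e i : ℝ) ≤ d l * d (l + i) := by exact_mod_cast h2
        _ ≤ (C * (l : ℝ) ^ q) * (C * ((l + i : ℕ) : ℝ) ^ q) := by gcongr
        _ ≤ (C * (i : ℝ) ^ (t * q)) * (C * (2 ^ q * (i : ℝ) ^ (max t 1 * q))) := by gcongr
        _ = (C * (C * 2 ^ q)) * (i : ℝ) ^ ((t + max t 1) * q) := by
            rw [hexp, Real.rpow_add hi0 (t * q) (max t 1 * q)]; ring
        _ ≤ _ := by
            gcongr
    rw [he] at this
    exact_mod_cast this
  have hcont : Tendsto (fun ε : ℝ => ((F + ε) + max (F + ε) 1) * (n + ε - m))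
      (nhdsWithin 0 (Set.Ioi 0)) (nhds (((F + 0) + max (F + 0) 1) * (n + 0 - m))) := by
    apply Tendsto.mono_left _ nhdsWithin_le_nhds
    apply Continuous.tendsto
    fun_prop
  have := ge_of_tendsto hcont (b := n) (by
    filter_upwards [self_mem_nhdsWithin] with ε hε using key ε hε)
  simpa using this
lemma end_bound {Q B M : Type} [Field Q] [Ring B] [Algebra Q B] [AddCommGroup M] [Module Q M]
    (ρ : B →ₐ[Q] Module.End Q M) (v : M) (hv : v ≠ 0) (W : Submodule Q B)
    (hW : FiniteDimensional Q W) (ev : B →ₗ[Q] M) (hev : ∀ b, ev b = ρ b v) (i l : ℕ)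
    (h : ∀ a ∈ W ^ i, a ≠ 0 → (1 : B) ∈ Submodule.span B {x : B | ∃ w ∈ W ^ l, x = a * w}) :
    Module.finrank Q (W ^ i : Submodule Q B) ≤
      Module.finrank Q ((W ^ l).map ev) * Module.finrank Q ((W ^ (l + i)).map ev) := by
  have hfg : ∀ j, FiniteDimensional Q (W ^ j : Submodule Q B) := fun j =>
    Module.Finite.iff_fg.2 ((Module.Finite.iff_fg.1 hW).pow j)
  have hfd : ∀ j, FiniteDimensional Q ((W ^ j).map ev) := fun j => by
    have := hfg j
    infer_instance
  have := hfg i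
  have := hfd l
  have := hfd (l + i)
  have hmem : ∀ a ∈ W ^ i, ∀ x ∈ (W ^ l).map ev, ρ a x ∈ (W ^ (l + i)).map ev := by
    rintro a ha _ ⟨b, hb, rfl⟩
    refine ⟨a * b, ?_, ?_⟩
    · rw [add_comm, pow_add]; exact Submodule.mul_mem_mul ha hb
    · rw [hev, hev, map_mul]; rfl
  let f : (W ^ i : Submodule Q B) →ₗ[Q] ((W ^ l).map ev) →ₗ[Q] ((W ^ (l + i)).map ev) :=
    LinearMap.mk₂ Q (fun a x => ⟨ρ a.1 x.1, hmem a.1 a.2 x.1 x.2⟩)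
      (fun a b x => by ext; simp) (fun c a x => by ext; simp)
      (fun a x y => by ext; simp) (fun c a x => by ext; simp)
  have hf : Function.Injective f := by
    rw [← LinearMap.ker_eq_bot, LinearMap.ker_eq_bot']
    rintro ⟨a, ha⟩ h0
    by_contra hne
    have ha0 : a ≠ 0 := fun h => hne (Subtype.ext h)
    have h1 := h a ha ha0
    have h2 : ∀ w ∈ W ^ l, ρ (a * w) v = 0 := by
      intro w hw
      have := congrArg Subtype.val (LinearMap.congr_fun h0 ⟨ev w, w, hw, rfl⟩)
      rw [map_mul, Module.End.mul_apply, ← hev w]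
      exact this
    have h3 : ∀ x ∈ Submodule.span B {x : B | ∃ w ∈ W ^ l, x = a * w}, ρ x v = 0 := by
      intro x hx
      induction hx using Submodule.span_induction with
      | mem x hx => obtain ⟨w, hw, rfl⟩ := hx; exact h2 w hw
      | zero => simp
      | add x y _ _ hx hy => simp [hx, hy]
      | smul b x _ hx => simp [hx]
    have h4 := h3 1 h1
    simp at h4
    exact hv h4
  refine (LinearMap.finrank_le_finrank_of_injective hf).trans ?_
  rw [Module.finrank_linearMap]

open TensorProduct in
lemma bc_pow {K A Q : Type} [Field K] [Ring A] [Algebra K A] [Field Q] [Algebra K Q]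
    (V : Submodule K A) (j : ℕ) :
    (V.baseChange Q) ^ j = (V ^ j).baseChange Q := by
  induction j with
  | zero =>
    rw [pow_zero, pow_zero, Submodule.one_eq_span, Submodule.one_eq_span,
      Submodule.baseChange_span]
    simp [Algebra.TensorProduct.one_def]
  | succ j ih =>
    rw [pow_succ, pow_succ, ih, Submodule.mul_eq_span_mul_set (V ^ j) V,
      Submodule.baseChange_span, Submodule.baseChange_eq_span, Submodule.baseChange_eq_span,
      Submodule.span_mul_span]
    congr 1
    have := Set.image_mul (Algebra.TensorProduct.includeRight : A →ₐ[K] Q ⊗[K] A)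
      (s := ((V ^ j : Submodule K A) : Set A)) (t := (V : Set A))
    exact this.symm

open TensorProduct in
lemma bc_fin {K A Q : Type} [Field K] [Ring A] [Algebra K A] [Field Q] [Algebra K Q]
    (V : Submodule K A) :
    Module.finrank Q (V.baseChange Q) = Module.finrank K V := by
  have hinj : Function.Injective (V.subtype.baseChange Q) := by
    rw [LinearMap.baseChange_eq_ltensor]
    exact Module.Flat.lTensor_preserves_injective_linearMap _ V.injective_subtype
  rw [← Module.finrank_baseChange (R := Q) (S := K) (M' := V)]
  exact ((LinearEquiv.ofInjective _ hinj).finrank_eq).symm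

open TensorProduct in
lemma bc_std {K A Q : Type} [Field K] [Ring A] [Algebra K A] [Field Q] [Algebra K Q]
    (V : Submodule K A) (hV : IsStdFilt K A V) : IsStdFilt Q (Q ⊗[K] A) (V.baseChange Q) := by
  have := hV.fin
  refine ⟨?_, ?_, ?_⟩
  · exact Submodule.tmul_mem_baseChange_of_mem 1 hV.one_mem
  · unfold Submodule.baseChange; infer_instance
  · set S := Algebra.adjoin Q ((V.baseChange Q : Submodule Q (Q ⊗[K] A)) : Set (Q ⊗[K] A)) with hS
    have h1 : Algebra.adjoin K (V : Set A) ≤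
        (S.restrictScalars K).comap (Algebra.TensorProduct.includeRight : A →ₐ[K] Q ⊗[K] A) := by
      rw [Algebra.adjoin_le_iff]
      intro a ha
      exact Algebra.subset_adjoin (Submodule.tmul_mem_baseChange_of_mem 1 ha)
    rw [hV.gen] at h1
    rw [eq_top_iff]
    intro x _
    induction x using TensorProduct.induction_on with
    | zero => exact S.zero_mem
    | add x y hx hy => exact S.add_mem (hx trivial) (hy trivial)
    | tmul q a =>
      have h2 : (1 : Q) ⊗ₜ[K] a ∈ S := h1 (x := a) trivial
      have h3 := S.smul_mem h2 q
      rwa [TensorProduct.smul_tmul', smul_eq_mul, mul_one] at h3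

open TensorProduct in
lemma d_bound {K A Q : Type} (m : ℕ) [Field K] [Ring A] [Algebra K A] [Field Q]
    [Module (MvPolynomial (Fin m) K) A] [IsScalarTower K (MvPolynomial (Fin m) K) A]
    [Algebra (MvPolynomial (Fin m) K) Q] [IsFractionRing (MvPolynomial (Fin m) K) Q]
    (S T : Submodule K A) (hS : FiniteDimensional K S) (hT : FiniteDimensional K T) (i : ℕ)
    (h : ∀ α : Fin m →₀ ℕ, (∀ j, α j ≤ i) → ∀ a ∈ S,
      (MvPolynomial.monomial α (1 : K)) • a ∈ T) :
    Module.finrank Q (Submodule.span Q ((fun a : A => (1 : Q) ⊗ₜ[MvPolynomial (Fin m) K] a) '' (S : Set A))) *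
      (i + 1) ^ m ≤ Module.finrank K T := by
  set P := MvPolynomial (Fin m) K with hP
  have hfin : Module.Finite Q
      (Submodule.span Q ((fun a : A => (1 : Q) ⊗ₜ[MvPolynomial (Fin m) K] a) '' (S : Set A))) := by
    obtain ⟨s, hs⟩ := Module.Finite.iff_fg.1 hS
    rw [Module.Finite.iff_fg]
    have : Submodule.span Q ((fun a : A => (1 : Q) ⊗ₜ[MvPolynomial (Fin m) K] a) '' (S : Set A)) =
        Submodule.span Q ((fun a : A => (1 : Q) ⊗ₜ[MvPolynomial (Fin m) K] a) '' (s : Set A)) := by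
      apply le_antisymm
      · rw [Submodule.span_le]
        rintro _ ⟨a, ha, rfl⟩
        rw [← hs] at ha
        simp only [SetLike.mem_coe] at ha ⊢
        induction ha using Submodule.span_induction with
        | mem x hx => exact Submodule.subset_span ⟨x, hx, rfl⟩
        | zero => simp
        | add x y _ _ hx hy => rw [tmul_add]; exact Submodule.add_mem _ hx hy
        | smul c x _ hx =>
          have : (1 : Q) ⊗ₜ[P] (c • x) = (algebraMap P Q (algebraMap K P c)) • ((1 : Q) ⊗ₜ[P] x) := by
            rw [← algebraMap_smul P c x, tmul_smul, algebraMap_smul Q (algebraMap K P c)]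
          rw [this]; exact Submodule.smul_mem _ _ hx
      · refine Submodule.span_mono (Set.image_mono ?_)
        rw [← hs]; exact Submodule.subset_span
    rw [this]
    exact Submodule.fg_span (s.finite_toSet.image _)
  obtain ⟨f, hf1, -, hf2⟩ := Submodule.exists_fun_fin_finrank_span_eq Q
    ((fun a : A => (1 : Q) ⊗ₜ[MvPolynomial (Fin m) K] a) '' (S : Set A))
  choose g hg1 hg2 using hf1
  have hg : LinearIndependent P g := by
    have h1 : LinearIndependent P f := hf2.restrict_scalars (by
      intro p q hpq
      simp only [Algebra.smul_def, mul_one] at hpq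
      exact IsFractionRing.injective P Q hpq)
    have h2 : f = (TensorProduct.mk P Q A 1) ∘ g := by
      funext k; exact (hg2 k).symm
    rw [h2] at h1
    exact LinearIndependent.of_comp _ h1
  let mon : (Fin m → Fin (i + 1)) → P := fun α =>
    MvPolynomial.monomial (Finsupp.equivFunOnFinite.symm fun j => (α j : ℕ)) (1 : K)
  have hmon : LinearIndependent K mon := by
    have h1 := (MvPolynomial.basisMonomials (Fin m) K).linearIndependent
    rw [MvPolynomial.coe_basisMonomials] at h1
    have h2 := h1.comp (fun α : Fin m → Fin (i + 1) =>
      (Finsupp.equivFunOnFinite.symm fun j => (α j : ℕ))) (by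
        intro α β hab
        have := Finsupp.equivFunOnFinite.symm.injective hab
        funext j
        exact Fin.ext (congrFun this j))
    exact h2
  have hli := linearIndependent_smul hmon hg
  have hcard := finrank_span_eq_card hli
  have hle : Submodule.span K (Set.range fun p : (Fin m → Fin (i + 1)) × _ => mon p.1 • g p.2) ≤ T := by
    rw [Submodule.span_le]
    rintro _ ⟨⟨α, k⟩, rfl⟩
    exact h _ (fun j => by simpa using Nat.lt_succ_iff.1 (α j).2) _ (hg1 k)
  have := Submodule.finrank_mono hle
  rw [hcard] at this
  simp only [Fintype.card_prod, Fintype.card_fun, Fintype.card_fin] at this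
  rw [mul_comm]
  exact this
lemma pow_mono_std {K A : Type} [Field K] [Ring A] [Algebra K A] {V : Submodule K A}
    (h1 : (1 : A) ∈ V) {i j : ℕ} (hij : i ≤ j) : V ^ i ≤ V ^ j := by
  obtain ⟨t, rfl⟩ := Nat.exists_eq_add_of_le hij
  rw [pow_add]
  intro x hx
  have h2 : (1 : A) ∈ V ^ t := by simpa using Submodule.pow_mem_pow V h1 t
  simpa using Submodule.mul_mem_mul hx h2

lemma exists_pow_std {K A : Type} [Field K] [Ring A] [Algebra K A] {V : Submodule K A}
    (hV : IsStdFilt K A V) (a : A) : ∃ c, a ∈ V ^ c := by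
  have ha : a ∈ Algebra.adjoin K (V : Set A) := by rw [hV.gen]; trivial
  induction ha using Algebra.adjoin_induction with
  | mem x hx => exact ⟨1, by simpa using hx⟩
  | algebraMap r => exact ⟨0, by simp⟩
  | add x y _ _ hx hy =>
    obtain ⟨c, hc⟩ := hx
    obtain ⟨c', hc'⟩ := hy
    exact ⟨max c c', Submodule.add_mem _ (pow_mono_std hV.one_mem (le_max_left _ _) hc)
      (pow_mono_std hV.one_mem (le_max_right _ _) hc')⟩
  | mul x y _ _ hx hy =>
    obtain ⟨c, hc⟩ := hx
    obtain ⟨c', hc'⟩ := hy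
    exact ⟨c + c', by rw [pow_add]; exact Submodule.mul_mem_mul hc hc'⟩

lemma monomial_box {K A : Type} [Field K] [Ring A] [Algebra K A] {V : Submodule K A}
    (hV : IsStdFilt K A V) (m : ℕ) (φ : MvPolynomial (Fin m) K →ₐ[K] A) :
    ∃ k : ℕ, ∀ i, ∀ α : Fin m →₀ ℕ, (∀ j, α j ≤ i) →
      φ (MvPolynomial.monomial α (1 : K)) ∈ V ^ (k * i) := by
  choose c hc using fun j => exists_pow_std hV (φ (MvPolynomial.X j))
  let c₀ := ∑ j, c j
  let U : Submodule K (MvPolynomial (Fin m) K) := (V ^ c₀).comap φ.toLinearMap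
  have hU : ∀ j, (MvPolynomial.X j : MvPolynomial (Fin m) K) ∈ U := fun j =>
    pow_mono_std hV.one_mem (Finset.single_le_sum (f := c) (fun _ _ => Nat.zero_le _)
      (Finset.mem_univ j)) (hc j)
  refine ⟨c₀ * m, fun i α hα => ?_⟩
  have h1 : ∀ s : Finset (Fin m), (∏ j ∈ s, (MvPolynomial.X j : MvPolynomial (Fin m) K) ^ α j) ∈
      U ^ (∑ j ∈ s, α j) := by
    intro s
    induction s using Finset.induction_on with
    | empty => simpa using (⟨1, map_one _⟩ : ∃ y : K, MvPolynomial.C (σ := Fin m) y = 1)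
    | insert j s hj ih =>
      rw [Finset.prod_insert hj, Finset.sum_insert hj, pow_add]
      exact Submodule.mul_mem_mul (Submodule.pow_mem_pow _ (hU j) _) ih
  have h2 : MvPolynomial.monomial α (1 : K) ∈ U ^ (∑ j, α j) := by
    have := h1 Finset.univ
    rw [MvPolynomial.monomial_eq, Finsupp.prod_fintype _ _ (by simp)]
    simpa using this
  have h3 : φ (MvPolynomial.monomial α (1 : K)) ∈ (U ^ (∑ j, α j)).map φ.toLinearMap :=
    ⟨_, h2, rfl⟩
  rw [Submodule.map_pow] at h3
  have h4 : U.map φ.toLinearMap ≤ V ^ c₀ := Submodule.map_comap_le _ _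
  have h5 := pow_le_pow_left' h4 (∑ j, α j) h3
  rw [← pow_mul] at h5
  refine pow_mono_std hV.one_mem ?_ h5
  rw [mul_assoc]
  refine Nat.mul_le_mul_left _ ?_
  calc ∑ j, α j ≤ ∑ j : Fin m, i := Finset.sum_le_sum fun j _ => hα j
    _ = m * i := by simp

open TensorProduct in
lemma key_mod {K A Q : Type} (m : ℕ) [Field K] [Ring A] [Algebra K A] [Field Q]
    [Module (MvPolynomial (Fin m) K) A] [IsScalarTower K (MvPolynomial (Fin m) K) A]
    [Algebra (MvPolynomial (Fin m) K) Q] [IsFractionRing (MvPolynomial (Fin m) K) Q]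
    [Algebra K Q] [IsScalarTower K (MvPolynomial (Fin m) K) Q]
    (φ : MvPolynomial (Fin m) K →ₐ[K] A) (hφ : Function.Injective φ)
    (hsm : ∀ (p : MvPolynomial (Fin m) K) (a : A), p • a = a * φ p)
    (V : Submodule K A) (hV : IsStdFilt K A V)
    (n : ℝ) (hGK : gkAlg K A V = ((n : ℝ) : EReal)) :
    (m : ℝ) ≤ n ∧ ∀ F : ℝ, 0 ≤ F → lfdAlg Q (V.baseChange Q) ≤ F →
      n ≤ (F + max F 1) * (n - m) := by
  have hVf : ∀ j, FiniteDimensional K (V ^ j : Submodule K A) := fun j =>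
    Module.Finite.iff_fg.2 ((Module.Finite.iff_fg.1 hV.fin).pow j)
  let P := MvPolynomial (Fin m) K
  let M := Q ⊗[P] A
  let v : M := (1 : Q) ⊗ₜ[P] (1 : A)
  have hv : v ≠ 0 := by
    let f : P →ₗ[P] A := LinearMap.toSpanSingleton P A 1
    have hf : Function.Injective f := by
      intro p q hpq
      simp only [f, LinearMap.toSpanSingleton_apply, hsm, one_mul] at hpq
      exact hφ hpq
    have hflat : Module.Flat P Q := IsLocalization.flat Q (nonZeroDivisors P)
    have h1 := Module.Flat.lTensor_preserves_injective_linearMap (M := Q) f hf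
    have h2 : LinearMap.lTensor Q f ((1 : Q) ⊗ₜ[P] (1 : P)) = v := by
      simp [f, v]
    intro h0
    rw [← h2] at h0
    have h3 := h1 (h0.trans (map_zero _).symm)
    have h4 := congrArg (TensorProduct.rid P Q) h3
    simp at h4
  let L : A →ₐ[K] Module.End P A :=
    { toFun := fun a =>
        { toFun := fun b => a * b
          map_add' := fun x y => mul_add _ _ _
          map_smul' := fun p x => by simp [hsm, mul_assoc] }
      map_one' := by ext; simp
      map_mul' := fun x y => by ext; simp [mul_assoc]
      map_zero' := by ext; simp
      map_add' := fun x y => by ext; simp [add_mul]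
      commutes' := fun k => by
        ext b
        simp [Algebra.smul_def] }
  let ρ₀ : A →ₐ[K] Module.End Q M := ((Module.End.baseChangeHom P Q A).restrictScalars K).comp L
  let ρ : (Q ⊗[K] A) →ₐ[Q] Module.End Q M := AlgHom.liftEquiv K Q A (Module.End Q M) ρ₀
  let ev : (Q ⊗[K] A) →ₗ[Q] M := (LinearMap.applyₗ v).comp ρ.toLinearMap
  have hev : ∀ a : A, ev ((1 : Q) ⊗ₜ[K] a) = (1 : Q) ⊗ₜ[P] a := by
    intro a
    have h1 : ρ ((1 : Q) ⊗ₜ[K] a) = ρ₀ a := by simp [ρ]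
    show ρ ((1 : Q) ⊗ₜ[K] a) v = _
    rw [h1]
    show (1 : Q) ⊗ₜ[P] (a * 1) = _
    rw [mul_one]
  let W := V.baseChange Q
  have hW : IsStdFilt Q (Q ⊗[K] A) W := bc_std V hV
  have hmap : ∀ j, (W ^ j).map ev =
      Submodule.span Q ((fun a : A => (1 : Q) ⊗ₜ[P] a) '' ((V ^ j : Submodule K A) : Set A)) := by
    intro j
    rw [bc_pow, Submodule.baseChange_eq_span, Submodule.map_span]
    congr 1
    ext x
    constructor
    · rintro ⟨_, ⟨a, ha, rfl⟩, rfl⟩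
      exact ⟨a, ha, (hev a).symm⟩
    · rintro ⟨a, ha, rfl⟩
      exact ⟨_, ⟨a, ha, rfl⟩, hev a⟩
  let d : ℕ → ℕ := fun j => Module.finrank Q ((W ^ j).map ev)
  let e : ℕ → ℕ := fun j => Module.finrank K (V ^ j : Submodule K A)
  obtain ⟨k, hk⟩ := monomial_box hV m φ
  have hde : ∀ i, d i * (i + 1) ^ m ≤ e ((k + 1) * i) := by
    intro i
    have := d_bound (Q := Q) m (V ^ i) (V ^ ((k + 1) * i)) (hVf _) (hVf _) i (by
      intro α hα a ha
      rw [hsm, add_mul, one_mul, add_comm, pow_add]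
      exact Submodule.mul_mem_mul ha (hk i α hα))
    rw [← hmap] at this
    exact this
  have hd : ∀ i, 1 ≤ d i := by
    intro i
    have h1 : v ∈ (W ^ i).map ev := by
      rw [hmap]
      refine Submodule.subset_span ⟨1, ?_, rfl⟩
      simpa using Submodule.pow_mem_pow V hV.one_mem i
    have hfd : FiniteDimensional Q ((W ^ i).map ev) := by
      have : FiniteDimensional Q (W ^ i : Submodule Q (Q ⊗[K] A)) :=
        Module.Finite.iff_fg.2 ((Module.Finite.iff_fg.1 hW.fin).pow i)
      infer_instance
    have : Nontrivial ((W ^ i).map ev) := ⟨⟨⟨v, h1⟩, 0, fun h => hv (congrArg Subtype.val h)⟩⟩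
    exact Module.finrank_pos (R := Q) (M := ((W ^ i).map ev))
  have hmn := num_m_le m (k + 1) (by omega) hGK hd hde
  refine ⟨hmn, fun F hF hl => ?_⟩
  refine num_main m (k + 1) (by omega) hF hGK hmn hde ?_
  intro t ht
  filter_upwards [gd_ev hl ht] with i hi
  have h1 : Module.finrank K (V ^ i : Submodule K A) =
      Module.finrank Q (W ^ i : Submodule Q (Q ⊗[K] A)) := by
    rw [bc_pow, bc_fin]
  show Module.finrank K (V ^ i : Submodule K A) ≤ _
  rw [h1]
  refine end_bound ρ v hv W hW.fin ev (fun b => rfl) i ⌊(i : ℝ) ^ t⌋₊ ?_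
  have h2 : lamFn Q W i < ((⌊(i : ℝ) ^ t⌋₊ + 1 : ℕ) : ℕ∞) :=
    lt_of_le_of_lt hi (by exact_mod_cast Nat.lt_succ_self _)
  unfold lamFn at h2
  rw [sInf_lt_iff] at h2
  obtain ⟨_, ⟨l, rfl, hl1⟩, hl2⟩ := h2
  have hl3 : l ≤ ⌊(i : ℝ) ^ t⌋₊ := by
    have : l < ⌊(i : ℝ) ^ t⌋₊ + 1 := by exact_mod_cast hl2
    omega
  intro a ha ha0
  refine Submodule.span_mono ?_ (hl1 a ha ha0)
  rintro _ ⟨w, hw, rfl⟩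
  exact ⟨w, pow_mono_std hW.one_mem hl3 hw, rfl⟩
lemma mem_box {K : Type} [Field K] {m t : ℕ} {p : MvPolynomial (Fin m) K} :
    p ∈ MvPolynomial.restrictDegree (Fin m) K t ↔ ∀ j, p.degreeOf j ≤ t := by
  rw [MvPolynomial.mem_restrictDegree]
  simp only [MvPolynomial.degreeOf_le_iff]
  exact ⟨fun h j s hs => h s hs j, fun h s hs j => h j s hs⟩

lemma box_finrank {K : Type} [Field K] (m t : ℕ) :
    Module.finrank K (MvPolynomial.restrictDegree (Fin m) K t) ≤ (t + 1) ^ m := by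
  let mon : (Fin m → Fin (t + 1)) → MvPolynomial (Fin m) K := fun α =>
    MvPolynomial.monomial (Finsupp.equivFunOnFinite.symm fun j => (α j : ℕ)) (1 : K)
  have h1 : MvPolynomial.restrictDegree (Fin m) K t ≤ Submodule.span K (Set.range mon) := by
    intro p hp
    rw [MvPolynomial.mem_restrictDegree] at hp
    rw [MvPolynomial.as_sum p]
    refine Submodule.sum_mem _ fun s hs => ?_
    have h2 : MvPolynomial.monomial s (p.coeff s) =
        p.coeff s • MvPolynomial.monomial s (1 : K) := by
      rw [MvPolynomial.smul_monomial, smul_eq_mul, mul_one]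
    rw [h2]
    refine Submodule.smul_mem _ _ (Submodule.subset_span
      ⟨fun j => ⟨s j, Nat.lt_succ_of_le (hp s hs j)⟩, ?_⟩)
    have h3 : (Finsupp.equivFunOnFinite.symm fun j => s j) = s := Finsupp.ext fun _ => rfl
    simp only [mon]
    rw [h3]
  have : FiniteDimensional K (Submodule.span K (Set.range mon)) :=
    FiniteDimensional.span_of_finite K (Set.finite_range mon)
  refine (Submodule.finrank_mono h1).trans ((finrank_range_le_card mon).trans ?_)
  simp

lemma upper_bound {K R : Type} [Field K] [CommRing R] [Algebra K R] (m : ℕ)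
    (φ : MvPolynomial (Fin m) K →ₐ[K] R) (U : Submodule K R) (hU : FiniteDimensional K U)
    (N : ℕ) (e : Fin N → R)
    (h1 : ∃ p : Fin N → MvPolynomial (Fin m) K, 1 = ∑ k, φ (p k) * e k)
    (hmul : ∀ u ∈ U, ∀ j, ∃ p : Fin N → MvPolynomial (Fin m) K, u * e j = ∑ k, φ (p k) * e k) :
    gammaDeg (fun i => (Module.finrank K (U ^ i : Submodule K R) : ℕ∞)) ≤ ((m : ℝ) : EReal) := by
  let box : ℕ → Submodule K (MvPolynomial (Fin m) K) := MvPolynomial.restrictDegree (Fin m) K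
  have hbox_mono : ∀ {s t : ℕ}, s ≤ t → box s ≤ box t := by
    intro s t hst p hp
    exact mem_box.2 fun j => (mem_box.1 hp j).trans hst
  let ℓ : ∀ t, (Fin N → box t) →ₗ[K] R := fun t =>
    { toFun := fun p => ∑ k, φ (p k).1 * e k
      map_add' := fun x y => by simp [add_mul, Finset.sum_add_distrib]
      map_smul' := fun c x => by simp [Finset.smul_sum] }
  let T : ℕ → Submodule K R := fun t => LinearMap.range (ℓ t)
  have hT : ∀ t (p : Fin N → MvPolynomial (Fin m) K), (∀ k, p k ∈ box t) →
      ∑ k, φ (p k) * e k ∈ T t := fun t p hp => ⟨fun k => ⟨p k, hp k⟩, rfl⟩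
  have hTmono : ∀ {s t : ℕ}, s ≤ t → T s ≤ T t := by
    rintro s t hst _ ⟨p, rfl⟩
    exact hT t (fun k => (p k).1) fun k => hbox_mono hst (p k).2
  have hTex : ∀ p : Fin N → MvPolynomial (Fin m) K, ∃ t, ∑ k, φ (p k) * e k ∈ T t := by
    intro p
    refine ⟨∑ k, (p k).totalDegree, hT _ p fun k => mem_box.2 fun j => ?_⟩
    exact (MvPolynomial.degreeOf_le_totalDegree _ _).trans
      (Finset.single_le_sum (f := fun k => (p k).totalDegree) (fun _ _ => Nat.zero_le _)
        (Finset.mem_univ k))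
  obtain ⟨s, hs⟩ := Module.Finite.iff_fg.1 hU
  have hc : ∃ c, (1 : R) ∈ T c ∧ ∀ u ∈ U, ∀ j, u * e j ∈ T c := by
    obtain ⟨p, hp⟩ := h1
    obtain ⟨t0, ht0⟩ := hTex p
    rw [← hp] at ht0
    have h2 : ∀ (u : s) (j : Fin N), ∃ t, (u : R) * e j ∈ T t := by
      intro u j
      obtain ⟨p, hp⟩ := hmul u (by rw [← hs]; exact Submodule.subset_span u.2) j
      rw [hp]
      exact hTex p
    choose t ht using h2
    refine ⟨t0 + ∑ u, ∑ j, t u j, hTmono (Nat.le_add_right _ _) ht0, ?_⟩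
    intro u hu j
    rw [← hs] at hu
    induction hu using Submodule.span_induction with
    | mem x hx =>
      refine hTmono ?_ (ht ⟨x, hx⟩ j)
      refine le_trans ?_ (Nat.le_add_left _ _)
      refine le_trans ?_ (Finset.single_le_sum (f := fun u => ∑ j, t u j)
        (fun _ _ => Nat.zero_le _) (Finset.mem_univ (⟨x, hx⟩ : s)))
      exact Finset.single_le_sum (f := fun j => t ⟨x, hx⟩ j) (fun _ _ => Nat.zero_le _)
        (Finset.mem_univ j)
    | zero => simp
    | add x y _ _ hx hy => rw [add_mul]; exact Submodule.add_mem _ hx hy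
    | smul a x _ hx => rw [smul_mul_assoc]; exact Submodule.smul_mem _ _ hx
  obtain ⟨c, hc1, hc2⟩ := hc
  have hstep : ∀ t, ∀ u ∈ U, ∀ x ∈ T t, u * x ∈ T (t + c) := by
    rintro t u hu _ ⟨p, rfl⟩
    show u * ∑ k, φ (p k).1 * e k ∈ _
    rw [Finset.mul_sum]
    refine Submodule.sum_mem _ fun k _ => ?_
    obtain ⟨q, hq⟩ := hc2 u hu k
    have h3 : u * (φ (p k).1 * e k) = ∑ l, φ ((p k).1 * (q l).1) * e l := by
      have hq' : ∑ l, φ (q l).1 * e l = u * e k := hq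
      calc u * (φ (p k).1 * e k) = φ (p k).1 * (u * e k) := by ring
        _ = _ := by
          rw [← hq', Finset.mul_sum]
          refine Finset.sum_congr rfl fun l _ => ?_
          rw [map_mul, mul_assoc]
    rw [h3]
    refine hT _ _ fun l => mem_box.2 fun j => ?_
    exact (MvPolynomial.degreeOf_mul_le _ _ _).trans
      (Nat.add_le_add (mem_box.1 (p k).2 j) (mem_box.1 (q l).2 j))
  have hpow : ∀ i, U ^ i ≤ T (c * (i + 1)) := by
    intro i
    induction i with
    | zero =>
      rw [pow_zero, Submodule.one_le]
      simpa using hc1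
    | succ i ih =>
      rw [pow_succ', Submodule.mul_le]
      intro u hu x hx
      exact hstep _ u hu x (ih hx)
  refine num_poly N c m fun i => ?_
  have hbf : ∀ t, FiniteDimensional K (box t) := fun t =>
    inferInstanceAs (Module.Finite K (MvPolynomial.restrictDegree (Fin m) K t))
  refine (Submodule.finrank_mono (hpow i)).trans ?_
  refine (LinearMap.finrank_range_le _).trans ?_
  rw [Module.finrank_pi_fintype]
  simp only [Finset.sum_const, Finset.card_univ, Fintype.card_fin, smul_eq_mul]
  exact Nat.mul_le_mul_left _ (box_finrank m _)
lemma main_U {K A R : Type} [Field K] [Ring A] [Nontrivial A] [Algebra K A] [CommRing R]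
    [Algebra K R] (ψ : R →ₐ[K] A) (hψ : Function.Injective ψ)
    (V : Submodule K A) (hV : IsStdFilt K A V)
    (n : ℝ) (hGK : gkAlg K A V = ((n : ℝ) : EReal))
    (U : Submodule K R) (hU : FiniteDimensional K U) :
    ∃ m : ℕ, gammaDeg (fun i => (Module.finrank K (U ^ i : Submodule K R) : ℕ∞)) ≤
      ((m : ℝ) : EReal) ∧ (m : ℝ) ≤ n ∧ ∀ F : ℝ, 0 ≤ F →
      lfdAlg (FractionRing (MvPolynomial (Fin m) K))
        (V.baseChange (FractionRing (MvPolynomial (Fin m) K))) ≤ F →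
      n ≤ (F + max F 1) * (n - m) := by
  have hR : Nontrivial R := ψ.toRingHom.domain_nontrivial
  obtain ⟨s, hs⟩ := Module.Finite.iff_fg.1 hU
  let D := Algebra.adjoin K (s : Set R)
  have hUD : ∀ u ∈ U, u ∈ D := by
    intro u hu
    rw [← hs] at hu
    exact Algebra.span_le_adjoin K _ hu
  have hD : Algebra.FiniteType K D := Subalgebra.fg_iff_finiteType D |>.1 (Subalgebra.fg_adjoin_finset s)
  obtain ⟨m, g, hg, hfin⟩ := exists_finite_inj_algHom_of_fg K D
  refine ⟨m, ?_, ?_⟩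
  · letI : Algebra (MvPolynomial (Fin m) K) D := g.toRingHom.toAlgebra
    have hfin' : Module.Finite (MvPolynomial (Fin m) K) D := hfin
    obtain ⟨N, e, he⟩ := Module.Finite.exists_fin (R := MvPolynomial (Fin m) K) (M := D)
    have hex : ∀ x : D, ∃ p : Fin N → MvPolynomial (Fin m) K,
        (x : R) = ∑ k, (D.val.comp g) (p k) * (e k : R) := by
      intro x
      have hx : x ∈ Submodule.span (MvPolynomial (Fin m) K) (Set.range e) := by
        rw [he]; trivial
      obtain ⟨p, hp⟩ := (Submodule.mem_span_range_iff_exists_fun _).1 hx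
      refine ⟨p, ?_⟩
      rw [← hp]
      simp only [AddSubmonoidClass.coe_finsetSum]
      rfl
    refine upper_bound m (D.val.comp g) U hU N (fun k => (e k : R)) (hex 1) ?_
    intro u hu j
    exact hex (⟨u, hUD u hu⟩ * e j)
  · let φ : MvPolynomial (Fin m) K →ₐ[K] A := ψ.comp (D.val.comp g)
    have hφ : Function.Injective φ := hψ.comp (Subtype.val_injective.comp hg)
    letI : Module (MvPolynomial (Fin m) K) A :=
      { smul := fun p a => a * φ p
        one_smul := fun a => by show a * φ 1 = a; simp
        mul_smul := fun p q a => by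
          show a * φ (p * q) = (a * φ q) * φ p
          rw [mul_comm p q, map_mul, mul_assoc]
        smul_zero := fun p => by show 0 * φ p = 0; simp
        smul_add := fun p a b => by show (a + b) * φ p = a * φ p + b * φ p; rw [add_mul]
        add_smul := fun p q a => by
          show a * φ (p + q) = a * φ p + a * φ q; rw [map_add, mul_add]
        zero_smul := fun a => by show a * φ 0 = 0; simp }
    haveI : IsScalarTower K (MvPolynomial (Fin m) K) A := ⟨fun c p a => by
      show a * φ (c • p) = c • (a * φ p)
      rw [map_smul, mul_smul_comm]⟩
    exact key_mod m φ hφ (fun _ _ => rfl) V hV n hGK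

lemma gd_mono {f g : ℕ → ℕ∞} (h : ∀ i, f i ≤ g i) : gammaDeg f ≤ gammaDeg g := by
  refine sInf_le_sInf ?_
  rintro _ ⟨r, rfl, hr⟩
  exact ⟨r, rfl, hr.mono fun i hi => (h i).trans hi⟩

lemma gd_bot_or (f : ℕ → ℕ∞) : gammaDeg f = ⊥ ∨ 0 ≤ gammaDeg f := by
  by_contra! hcon
  obtain ⟨h1, h2⟩ := hcon
  apply h1
  unfold gammaDeg at h2
  rw [sInf_lt_iff] at h2
  obtain ⟨_, ⟨r, rfl, hr⟩, hr0⟩ := h2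
  have hr0 : r < 0 := by exact_mod_cast hr0
  rw [eq_bot_iff]
  refine le_of_forall_gt_imp_ge_of_dense fun x hx => ?_
  induction x with
  | bot => simp at hx
  | top => exact le_top
  | coe x =>
    refine sInf_le ⟨x, rfl, ?_⟩
    filter_upwards [hr, eventually_ge_atTop 2] with i hi h2
    have h3 : ⌊(i : ℝ) ^ r⌋₊ = 0 := by
      rw [Nat.floor_eq_zero]
      exact Real.rpow_lt_one_of_one_lt_of_neg (by exact_mod_cast h2) hr0
    rw [h3] at hi
    exact hi.trans (by simp)

lemma lfd_le_fd {K A : Type} [Field K] [Ring A] [Algebra K A] (V : Submodule K A) :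
    lfdAlg K V ≤ fdAlg K V := by
  refine gd_mono fun i => sInf_le_sInf ?_
  rintro _ ⟨l, rfl, hl⟩
  refine ⟨l, rfl, fun a ha ha0 => ?_⟩
  have h1 := hl a ha ha0
  have h2 : Submodule.span K
      {x : A | ∃ u ∈ (V ^ l : Submodule K A), ∃ w ∈ (V ^ l : Submodule K A), x = u * a * w} ≤
      (Submodule.span A {x : A | ∃ w ∈ (V ^ l : Submodule K A), x = a * w}).restrictScalars K := by
    rw [Submodule.span_le]
    rintro _ ⟨u, hu, w, hw, rfl⟩
    rw [mul_assoc]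
    exact Submodule.smul_mem _ u (Submodule.subset_span ⟨w, hw, rfl⟩)
  exact h2 h1

lemma sup_bot_or (S : Set EReal) (h : ∀ x ∈ S, x = ⊥ ∨ 0 ≤ x) : sSup S = ⊥ ∨ 0 ≤ sSup S := by
  by_cases h1 : ∃ x ∈ S, 0 ≤ x
  · obtain ⟨x, hx, hx0⟩ := h1
    exact Or.inr (hx0.trans (le_sSup hx))
  · left
    rw [sSup_eq_bot]
    intro x hx
    exact (h x hx).resolve_right fun h0 => h1 ⟨x, hx, h0⟩

lemma final_arith (n : ℝ) (m : ℕ) (hmn : (m : ℝ) ≤ n) (hn : 0 < n) (G : EReal)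
    (hG : G = ⊥ ∨ 0 ≤ G)
    (h : ∀ F : ℝ, 0 ≤ F → G = F → n ≤ (F + max F 1) * (n - m)) :
    ((m : ℝ) : EReal) ≤ (n : EReal) * (1 - 1 / (G + max G 1)) := by
  induction G with
  | bot =>
    simp
    exact_mod_cast hmn
  | top =>
    simp
    exact_mod_cast hmn
  | coe F =>
    have hF : 0 ≤ F := by
      rcases hG with h0 | h0
      · simp at h0
      · exact_mod_cast h0
    have h1 := h F hF rfl
    have h2 : 0 < F + max F 1 := by
      have := le_max_right F 1
      linarith
    have h3 : (m : ℝ) ≤ n * (1 - 1 / (F + max F 1)) := by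
      have h4 : n / (F + max F 1) ≤ n - m := by
        rw [div_le_iff₀ h2]; linarith
      have h5 : n * (1 - 1 / (F + max F 1)) = n - n / (F + max F 1) := by ring
      rw [h5]; linarith
    have h6 : (n : EReal) * (1 - 1 / ((F : EReal) + max (F : EReal) 1)) =
        ((n * (1 - 1 / (F + max F 1)) : ℝ) : EReal) := by
      rw [EReal.coe_mul, EReal.coe_sub, EReal.coe_div, EReal.coe_add,
        EReal.coe_strictMono.monotone.map_max, EReal.coe_one]
    rw [h6]
    exact_mod_cast h3

open TensorProduct in
set_option maxHeartbeats 1000000 in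
set_option synthInstance.maxHeartbeats 1000000 in
/-- Let `A` be a central simple finitely generated `K`-algebra of Gelfand-Kirillov
dimension `0 < n < ∞` and let `C` be a commutative subalgebra of `A`. Then
`GK(C) ≤ GK(A) (1 − 1/(f_A + max{f_A, 1}))`, where
`f_A = max { d_{Q_m}(Q_m ⊗ A) | 0 ≤ m ≤ n }`, `Q_0 = K`, `Q_m = K(x_1, …, x_m)` is the
rational function field (the fraction field of the polynomial ring in `m` variables)
and `d` is the filter dimension `fd` or the left filter dimension `lfd` (both cases are
stated). -/
theorem gk_commutative_subalgebra_le
    (K A : Type) [Field K] [Ring A] [Algebra K A] [IsSimpleRing A]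
    (hcentral : Subalgebra.center K A = ⊥)
    (V : Submodule K A) (hV : IsStdFilt K A V)
    (n : ℝ) (hn : 0 < n) (hGK : gkAlg K A V = ((n : ℝ) : EReal))
    (C : Subalgebra K A) (hC : ∀ x ∈ C, ∀ y ∈ C, x * y = y * x)
    (fA fA' : EReal)
    (hfA : fA = sSup { x : EReal | ∃ m : ℕ, (m : ℝ) ≤ n ∧
      ∃ Vm : Submodule (FractionRing (MvPolynomial (Fin m) K))
          ((FractionRing (MvPolynomial (Fin m) K)) ⊗[K] A),
        IsStdFilt (FractionRing (MvPolynomial (Fin m) K))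
          ((FractionRing (MvPolynomial (Fin m) K)) ⊗[K] A) Vm ∧
        x = fdAlg (FractionRing (MvPolynomial (Fin m) K))
          (A := (FractionRing (MvPolynomial (Fin m) K)) ⊗[K] A) Vm })
    (hfA' : fA' = sSup { x : EReal | ∃ m : ℕ, (m : ℝ) ≤ n ∧
      ∃ Vm : Submodule (FractionRing (MvPolynomial (Fin m) K))
          ((FractionRing (MvPolynomial (Fin m) K)) ⊗[K] A),
        IsStdFilt (FractionRing (MvPolynomial (Fin m) K))
          ((FractionRing (MvPolynomial (Fin m) K)) ⊗[K] A) Vm ∧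
        x = lfdAlg (FractionRing (MvPolynomial (Fin m) K))
          (A := (FractionRing (MvPolynomial (Fin m) K)) ⊗[K] A) Vm }) :
    gkSubalgebra K A C ≤ gkAlg K A V * (1 - 1 / (fA + max fA 1)) ∧
    gkSubalgebra K A C ≤ gkAlg K A V * (1 - 1 / (fA' + max fA' 1)) := by
  have main : ∀ G : EReal, (G = ⊥ ∨ 0 ≤ G) →
      (∀ m : ℕ, (m : ℝ) ≤ n → lfdAlg (FractionRing (MvPolynomial (Fin m) K))
        (V.baseChange (FractionRing (MvPolynomial (Fin m) K))) ≤ G) →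
      gkSubalgebra K A C ≤ gkAlg K A V * (1 - 1 / (G + max G 1)) := by
    intro G hG0 hG
    refine iSup_le ?_
    rintro ⟨U, hU, -⟩
    letI : CommRing C :=
      { (inferInstance : Ring C) with
        mul_comm := fun x y => Subtype.ext (hC x.1 x.2 y.1 y.2) }
    obtain ⟨m, h1, h2, h3⟩ := main_U C.val Subtype.val_injective V hV n hGK U hU
    refine le_trans h1 ?_
    rw [hGK]
    exact final_arith n m h2 hn G hG0 fun F hF hGF => h3 F hF (hGF ▸ hG m h2)
  refine ⟨main fA ?_ ?_, main fA' ?_ ?_⟩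
  · rw [hfA]
    refine sup_bot_or _ ?_
    rintro _ ⟨m, -, Vm, -, rfl⟩
    exact gd_bot_or _
  · intro m hm
    refine (lfd_le_fd _).trans ?_
    rw [hfA]
    exact le_sSup ⟨m, hm, _, bc_std V hV, rfl⟩
  · rw [hfA']
    refine sup_bot_or _ ?_
    rintro _ ⟨m, -, Vm, -, rfl⟩
    exact gd_bot_or _
  · intro m hm
    rw [hfA']
    exact le_sSup ⟨m, hm, _, bc_std V hV, rfl⟩

end
end
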